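/- arXiv:math/0606753 — 2 statements merged into one kernel-verified Lean document; each statement's English description precedes it below -/
import Mathlib

section
/- Let H ∈ (0,1), K ∈ (0,1] and 0 < a < b. Then the bifractional Brownian motion B₀^{H,K} is strongly locally φ-nondeterministic on [a,b] with φ(r) = r^{2HK}: there exist constants c > 0 and r₀ > 0 such that for every t ∈ [a,b], every r with 0 < r ≤ min{t, r₀}, every n ∈ ℕ, all points s₁,…,s_n ∈ [a,b] satisfying r ≤ |s_i − t| ≤ r₀ for each i, and all real numbers a₁,…,a_n, one has R^{H,K}(t,t) − 2 Σ_{i=1}^n a_i R^{H,K}(s_i,t) + Σ_{i=1}^n Σ_{j=1}^n a_i a_j R^{H,K}(s_i,s_j) ≥ c · r^{2HK}. (The left-hand side equals E[(B₀^{H,K}(t) − Σ_i a_i B₀^{H,K}(s_i))²], so this says Var(B₀^{H,K}(t) | B₀^{H,K}(s) : s ∈ [a,b], r ≤ |s−t| ≤ r₀) ≥ c r^{2HK}.) -/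
/-- The bifractional covariance function
`R^{H,K}(s,t) = 2^{-K} [(t^{2H} + s^{2H})^K - |t-s|^{2HK}]`. -/
noncomputable def Rbif (H K s t : ℝ) : ℝ :=
  (2 : ℝ) ^ (-K) * ((t ^ (2 * H) + s ^ (2 * H)) ^ K - |t - s| ^ (2 * H * K))

section BifAux
open MeasureTheory Set
open scoped FourierTransform SchwartzMap

def PSDk {ι : Type} [Fintype ι] (A : ι → ι → ℝ) : Prop :=
  (∀ i j, A i j = A j i) ∧ ∀ w : ι → ℝ, 0 ≤ ∑ i, ∑ j, w i * w j * A i j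

lemma PSDk.toMat {ι : Type} [Fintype ι] {A : ι → ι → ℝ} :
    PSDk A ↔ (Matrix.of A).PosSemidef := by
  classical
  have e : ∀ w : ι → ℝ, star w ⬝ᵥ ((Matrix.of A).mulVec w) = ∑ i, ∑ j, w i * w j * A i j := by
    intro w
    simp only [dotProduct, Matrix.mulVec, Finset.mul_sum]
    refine Finset.sum_congr rfl fun i _ => Finset.sum_congr rfl fun j _ => ?_
    simp; ring
  constructor
  · rintro ⟨h1, h2⟩
    refine Matrix.PosSemidef.of_dotProduct_mulVec_nonneg ?_ ?_
    · ext i j; simp [Matrix.conjTranspose_apply, h1 i j]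
    · intro w; rw [e]; exact h2 w
  · intro h
    refine ⟨fun i j => ?_, fun w => ?_⟩
    · have := congrFun (congrFun h.1 j) i
      simpa using this
    · rw [← e]; exact h.dotProduct_mulVec_nonneg w

lemma PSDk.mul {ι : Type} [Fintype ι] {A B : ι → ι → ℝ} (hA : PSDk A) (hB : PSDk B) :
    PSDk (fun i j => A i j * B i j) := by
  rw [PSDk.toMat] at *
  exact hA.hadamard hB

lemma PSDk.add {ι : Type} [Fintype ι] {A B : ι → ι → ℝ} (hA : PSDk A) (hB : PSDk B) :
    PSDk (fun i j => A i j + B i j) := by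
  refine ⟨fun i j => by simp only [hA.1 i j, hB.1 i j], fun w => ?_⟩
  have := add_nonneg (hA.2 w) (hB.2 w)
  simpa only [mul_add, Finset.sum_add_distrib] using this

lemma PSDk.smul {ι : Type} [Fintype ι] {A : ι → ι → ℝ} (hA : PSDk A) {c : ℝ} (hc : 0 ≤ c) :
    PSDk (fun i j => c * A i j) := by
  refine ⟨fun i j => by simp only [hA.1 i j], fun w => ?_⟩
  have := mul_nonneg hc (hA.2 w)
  simp only [Finset.mul_sum] at this
  refine this.trans_eq (Finset.sum_congr rfl fun i _ => Finset.sum_congr rfl fun j _ => by ring)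

lemma PSDk.rankOne {ι : Type} [Fintype ι] (v : ι → ℝ) :
    PSDk (fun i j => v i * v j) := by
  refine ⟨fun i j => mul_comm _ _, fun w => ?_⟩
  have := sq_nonneg (∑ i, w i * v i)
  rw [sq, Finset.sum_mul_sum] at this
  refine this.trans_eq (Finset.sum_congr rfl fun i _ => Finset.sum_congr rfl fun j _ => by ring)

lemma PSDk.pow {ι : Type} [Fintype ι] {A : ι → ι → ℝ} (hA : PSDk A) (k : ℕ) :
    PSDk (fun i j => A i j ^ k) := by
  induction k with
  | zero => simpa using PSDk.rankOne (fun _ : ι => (1:ℝ))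
  | succ k ih => simpa only [pow_succ] using ih.mul hA

lemma PSDk.sum {ι : Type} [Fintype ι] {A : ℕ → ι → ι → ℝ} (hA : ∀ k, PSDk (A k)) (s : Finset ℕ) :
    PSDk (fun i j => ∑ k ∈ s, A k i j) := by
  classical
  induction s using Finset.induction_on with
  | empty => simp [PSDk]
  | insert a s ha ih => simpa only [Finset.sum_insert ha] using (hA a).add ih

lemma PSDk.hasSum {ι : Type} [Fintype ι] {A : ℕ → ι → ι → ℝ} (hA : ∀ k, PSDk (A k))
    {B : ι → ι → ℝ} (hB : ∀ i j, HasSum (fun k => A k i j) (B i j)) : PSDk B := by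
  refine ⟨fun i j => ?_, fun w => ?_⟩
  · refine (hB i j).unique ?_
    simpa only [(hA _).1 i j] using hB j i
  · have : HasSum (fun k => ∑ i, ∑ j, w i * w j * A k i j) (∑ i, ∑ j, w i * w j * B i j) :=
      hasSum_sum fun i _ => hasSum_sum fun j _ => (hB i j).mul_left _
    exact this.nonneg fun k => (hA k).2 w

lemma PSDk.exp {ι : Type} [Fintype ι] {A : ι → ι → ℝ} (hA : PSDk A) :
    PSDk (fun i j => Real.exp (A i j)) := by
  refine PSDk.hasSum (A := fun k i j => (k.factorial : ℝ)⁻¹ * A i j ^ k)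
    (fun k => (hA.pow k).smul (by positivity)) fun i j => ?_
  have := NormedSpace.expSeries_div_hasSum_exp (A i j)
  rw [← Real.exp_eq_exp_ℝ] at this
  simpa only [div_eq_inv_mul] using this

lemma PSDk.exp_sub {ι : Type} [Fintype ι] {A : ι → ι → ℝ} (hA : PSDk A) :
    PSDk (fun i j => Real.exp (A i j) - A i j) := by
  refine PSDk.hasSum (A := fun k i j => if k = 1 then 0 else (k.factorial : ℝ)⁻¹ * A i j ^ k)
    (fun k => ?_) fun i j => ?_
  · split_ifs
    · simp [PSDk]
    · exact (hA.pow k).smul (by positivity)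
  have := NormedSpace.expSeries_div_hasSum_exp (A i j)
  rw [← Real.exp_eq_exp_ℝ] at this
  have h2 := this.sub (hasSum_ite_eq 1 (A i j))
  refine (funext fun k => ?_ : (fun k : ℕ => if k = 1 then (0:ℝ) else (k.factorial : ℝ)⁻¹ * A i j ^ k) = _) ▸ h2
  by_cases hk : k = 1
  · simp [hk]
  · simp [hk, div_eq_inv_mul]

/-- Sum-zero weights give nonpositive forms. -/
def CND (f : ℝ → ℝ) : Prop :=
  ∀ (ι : Type) [Fintype ι] (s w : ι → ℝ), ∑ i, w i = 0 →
    ∑ i, ∑ j, w i * w j * f (s i - s j) ≤ 0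

def PDf (f : ℝ → ℝ) : Prop :=
  ∀ (ι : Type) [Fintype ι] (s : ι → ℝ), PSDk (fun i j => f (s i - s j))

lemma CND.psd {f : ℝ → ℝ} (hf : CND f) (h0 : f 0 = 0) (he : ∀ u, f (-u) = f u)
    {ι : Type} [Fintype ι] (s : ι → ℝ) :
    PSDk (fun i j => f (s i) + f (s j) - f (s i - s j)) := by
  refine ⟨fun i j => ?_, fun w => ?_⟩
  · show f (s i) + f (s j) - f (s i - s j) = f (s j) + f (s i) - f (s j - s i)
    rw [← he (s i - s j), neg_sub]; ring
  · have := hf (Option ι) (fun o => o.elim 0 s) (fun o => o.elim (-∑ i, w i) w)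
      (by simp [Fintype.sum_option])
    simp only [Fintype.sum_option, Option.elim, sub_zero, h0, zero_sub, he] at this
    have e : ∑ i, ∑ j, w i * w j * (f (s i) + f (s j) - f (s i - s j)) =
      (∑ i, w i * f (s i)) * (∑ i, w i) + (∑ i, w i) * (∑ i, w i * f (s i))
       - ∑ i, ∑ j, w i * w j * f (s i - s j) := by
      rw [Finset.sum_mul_sum, Finset.sum_mul_sum, ← Finset.sum_add_distrib, ← Finset.sum_sub_distrib]
      refine Finset.sum_congr rfl fun i _ => ?_
      rw [← Finset.sum_add_distrib, ← Finset.sum_sub_distrib]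
      exact Finset.sum_congr rfl fun j _ => by ring
    have e1 : ∑ x, -(∑ i, w i) * w x * f (s x) = -(∑ i, w i) * ∑ x, w x * f (s x) := by
      rw [Finset.mul_sum]; exact Finset.sum_congr rfl fun j _ => by ring
    have e2 : ∑ x, w x * (-(∑ i, w i)) * f (s x) = -(∑ i, w i) * ∑ x, w x * f (s x) := by
      rw [Finset.mul_sum]; exact Finset.sum_congr rfl fun j _ => by ring
    rw [Finset.sum_add_distrib, e1, e2] at this
    rw [e]; nlinarith

lemma CND.exp {f : ℝ → ℝ} (hf : CND f) (h0 : f 0 = 0) (he : ∀ u, f (-u) = f u)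
    {ι : Type} [Fintype ι] (s : ι → ℝ) {τ : ℝ} (hτ : 0 ≤ τ) :
    PSDk (fun i j => Real.exp (-τ * f (s i - s j))) := by
  have := (PSDk.rankOne fun i => Real.exp (-τ * f (s i))).mul
    (((hf.psd h0 he s).smul hτ).exp)
  convert this using 3 with i j
  rw [← Real.exp_add, ← Real.exp_add]; ring_nf

/-- isolated index -/
lemma PSDk.isolated {ι : Type} [Fintype ι] {A : ι → ι → ℝ} (hA : PSDk A) (i0 : ι)
    (h0 : ∀ j, j ≠ i0 → A i0 j = 0) (w : ι → ℝ) (hw : w i0 = 1) :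
    A i0 i0 ≤ ∑ i, ∑ j, w i * w j * A i j := by
  classical
  have h1 := hA.2 (fun i => w i - if i = i0 then 1 else 0)
  have e0 : ∀ f : ι → ℝ, (∀ j, j ≠ i0 → f j = 0) → ∑ j, f j = f i0 := fun f hf =>
    Finset.sum_eq_single i0 (fun j _ hj => hf j hj) (by simp)
  have r : ∑ j, w i0 * w j * A i0 j = A i0 i0 := by
    rw [e0 _ (fun j hj => by rw [h0 j hj]; ring), hw]; ring
  have e : ∑ i, ∑ j, w i * w j * A i j = A i0 i0 +
    ∑ i, ∑ j, (w i - if i = i0 then 1 else 0) * (w j - if j = i0 then 1 else 0) * A i j := by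
    rw [← Finset.add_sum_erase _ _ (Finset.mem_univ i0), r]
    congr 1
    rw [← Finset.add_sum_erase (a := i0) (f := fun i => ∑ j, (w i - if i = i0 then 1 else 0) * (w j - if j = i0 then 1 else 0) * A i j) _ (Finset.mem_univ i0)]
    simp only [hw, if_true, sub_self, zero_mul, Finset.sum_const_zero, zero_add]
    refine Finset.sum_congr rfl fun i hi => Finset.sum_congr rfl fun j _ => ?_
    have hi' : i ≠ i0 := by simpa using hi
    by_cases hj : j = i0
    · subst hj; rw [hA.1 i j, h0 i hi']; ring
    · simp [hi', hj]
  linarith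

/-- key exponential lower bound -/
lemma exp_lower {ψ h : ℝ → ℝ} (hψ0 : ψ 0 = 0) (hψe : ∀ u, ψ (-u) = ψ u)
    (hhe : ∀ u, h (-u) = h u) (hh : PDf h) (hc : CND (fun u => ψ u + h u))
    {ι : Type} [Fintype ι] (p w : ι → ℝ) (i0 : ι) (hw : w i0 = 1)
    (hs : ∀ j, j ≠ i0 → h (p i0 - p j) = 0) {τ : ℝ} (hτ : 0 ≤ τ) :
    τ * Real.exp (-τ * h 0) * h 0 ≤ ∑ i, ∑ j, w i * w j * Real.exp (-τ * ψ (p i - p j)) := by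
  have hc1 : CND (fun u => ψ u + h u - h 0) := by
    intro κ _ s v hv
    have := hc κ s v hv
    have z : ∑ i, ∑ j, v i * v j * h 0 = 0 := by
      simp only [← Finset.sum_mul, ← Finset.mul_sum, hv]; simp
    simp only [mul_sub, Finset.sum_sub_distrib, z] at this ⊢
    linarith
  have P := hc1.exp (by simp [hψ0]) (by simp [hψe, hhe]) p hτ
  have B := (hh ι p).smul hτ
  have D := (P.mul B.exp_sub).2 w
  have I := (P.mul B).isolated i0 (fun j hj => by simp only [hs j hj]; ring) w hw
  have S : 0 ≤ (∑ i, ∑ j, w i * w j * (Real.exp (-τ * (ψ (p i - p j) + h (p i - p j) - h 0)) *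
      Real.exp (τ * h (p i - p j)))) - τ * h 0 := by
    simp only [mul_sub, Finset.sum_sub_distrib] at D
    simp only [mul_sub] at I
    simp only [sub_self, hψ0] at I
    simp at I
    simp only [mul_sub]
    simp at D ⊢
    linarith
  have E : ∑ i, ∑ j, w i * w j * (Real.exp (-τ * (ψ (p i - p j) + h (p i - p j) - h 0)) *
      Real.exp (τ * h (p i - p j))) = Real.exp (τ * h 0) *
      ∑ i, ∑ j, w i * w j * Real.exp (-τ * ψ (p i - p j)) := by
    simp only [Finset.mul_sum]
    refine Finset.sum_congr rfl fun i hi => Finset.sum_congr rfl fun j _ => ?_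
    rw [← Real.exp_add, mul_left_comm, ← Real.exp_add]; ring_nf
  rw [E] at S
  have := mul_nonneg (Real.exp_pos (-τ * h 0)).le S
  rw [mul_sub, ← mul_assoc, ← Real.exp_add] at this
  simp at this
  simp; linarith


lemma int_pow {F : ℝ → ℝ} (hF : Continuous F) {A B m p : ℝ} (hp : 0 < p) (hpm : p < m)
    (hA : ∀ x, 0 < x → |F x| ≤ A * x ^ m) (hB : ∀ x, 0 < x → |F x| ≤ B) :
    IntegrableOn (fun x => F x * x ^ (-1 - p)) (Ioi 0) := by
  have hmeas : ∀ s : Set ℝ, AEStronglyMeasurable (fun x : ℝ => F x * x ^ (-1 - p)) (volume.restrict s) :=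
    fun s => (by fun_prop : Measurable (fun x : ℝ => F x * x ^ (-1 - p))).aestronglyMeasurable
  rw [← Ioc_union_Ioi_eq_Ioi zero_le_one]
  refine IntegrableOn.union ?_ ?_
  · have h1 : IntegrableOn (fun x : ℝ => A * x ^ (m - 1 - p)) (Ioc 0 1) := by
      have := (intervalIntegral.intervalIntegrable_rpow' (a := 0) (b := 1) (r := m - 1 - p) (by linarith)).const_mul A
      rwa [intervalIntegrable_iff_integrableOn_Ioc_of_le zero_le_one] at this
    refine Integrable.mono' h1 (hmeas _) ?_
    refine (ae_restrict_iff' measurableSet_Ioc).2 (Filter.Eventually.of_forall fun x hx => ?_)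
    rw [Real.norm_eq_abs, abs_mul, abs_of_pos (Real.rpow_pos_of_pos hx.1 _),
      show m - 1 - p = m + (-1 - p) by ring, Real.rpow_add hx.1, ← mul_assoc]
    exact mul_le_mul_of_nonneg_right (hA x hx.1) (Real.rpow_nonneg hx.1.le _)
  · have h1 : IntegrableOn (fun x : ℝ => B * x ^ (-1 - p)) (Ioi 1) :=
      (integrableOn_Ioi_rpow_of_lt (by linarith) one_pos).const_mul B
    refine Integrable.mono' h1 (hmeas _) ?_
    refine (ae_restrict_iff' measurableSet_Ioi).2 (Filter.Eventually.of_forall fun x hx => ?_)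
    have hx0 : 0 < x := one_pos.trans hx
    rw [Real.norm_eq_abs, abs_mul, abs_of_pos (Real.rpow_pos_of_pos hx0 _)]
    exact mul_le_mul_of_nonneg_right (hB x hx0) (Real.rpow_nonneg hx0.le _)

lemma int_pow_scale {F : ℝ → ℝ} {p u : ℝ} (hu : 0 < u) :
    ∫ x in Ioi (0:ℝ), F (u * x) * x ^ (-1 - p) = u ^ p * ∫ x in Ioi (0:ℝ), F x * x ^ (-1 - p) := by
  have := integral_comp_mul_left_Ioi (fun x => F x * x ^ (-1 - p)) 0 hu
  rw [mul_zero, smul_eq_mul] at this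
  have e : ∀ x ∈ Ioi (0:ℝ), F (u * x) * x ^ (-1 - p) = u ^ (1 + p) * (F (u * x) * (u * x) ^ (-1 - p)) := by
    intro x hx
    rw [Real.mul_rpow hu.le (le_of_lt hx), show -1 - p = -(1 + p) by ring, Real.rpow_neg hu.le]
    have := (Real.rpow_pos_of_pos hu (1 + p)).ne'
    field_simp
  rw [setIntegral_congr_fun measurableSet_Ioi e, integral_const_mul, this, Real.rpow_add hu, Real.rpow_one]
  field_simp

lemma int_pow_pos {F : ℝ → ℝ} {p : ℝ} (hF0 : ∀ x, 0 < x → 0 ≤ F x)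
    {y z : ℝ} (hy : 0 < y) (hyz : y < z) (hpos : ∀ x ∈ Ioc y z, 0 < F x)
    (hi : IntegrableOn (fun x => F x * x ^ (-1 - p)) (Ioi 0)) :
    0 < ∫ x in Ioi (0:ℝ), F x * x ^ (-1 - p) := by
  rw [setIntegral_pos_iff_support_of_nonneg_ae _ hi]
  · refine lt_of_lt_of_le ?_ (measure_mono (s := Ioc y z) ?_)
    · simp [hyz]
    · intro x hx
      have hx0 : 0 < x := hy.trans hx.1
      exact ⟨(mul_pos (hpos x hx) (Real.rpow_pos_of_pos hx0 _)).ne', hx0⟩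
  · refine (ae_restrict_iff' measurableSet_Ioi).2 (Filter.Eventually.of_forall fun x hx => ?_)
    exact mul_nonneg (hF0 x hx) (Real.rpow_nonneg (le_of_lt hx) _)

lemma exists_spec : ∃ G : ℝ → ℝ, Continuous G ∧ (∀ x, 0 ≤ G x) ∧ IntegrableOn G (Ioi 0) ∧
    (∃ C, 0 < C ∧ ∀ p : ℝ, p < 2 → 0 < p → ∀ x, 0 < x → G x ≤ C * x ^ (-1 - p)) ∧
    (∀ u : ℝ, 1 ≤ |u| → ∫ x in Ioi (0:ℝ), Real.cos (2 * Real.pi * u * x) * G x = 0) ∧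
    0 < ∫ x in Ioi (0:ℝ), G x := by
  let b : ContDiffBump (0:ℝ) := ⟨1/4, 1/2, by norm_num, by norm_num⟩
  have hbs : HasCompactSupport (fun x => (b x : ℂ)) := b.hasCompactSupport.comp_left (g := Complex.ofReal) (by simp)
  have hbd : ContDiff ℝ ((⊤ : ℕ∞) : WithTop ℕ∞) (fun x => (b x : ℂ)) := Complex.ofRealCLM.contDiff.comp b.contDiff
  have htr : ∀ u : ℝ, HasCompactSupport (fun x => (b (x + u) : ℂ)) := fun u =>
    hbs.comp_homeomorph (Homeomorph.addRight u)
  have htd : ∀ u : ℝ, ContDiff ℝ ((⊤ : ℕ∞) : WithTop ℕ∞) (fun x => (b (x + u) : ℂ)) := fun u =>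
    hbd.comp (contDiff_id.add contDiff_const)
  let f : ℝ → 𝓢(ℝ, ℂ) := fun u => (htr u).toSchwartzMap (htd u)
  have hf : ∀ u x, f u x = (b (x + u) : ℂ) := fun u x => rfl
  let g : ℝ → ℝ := fun x => ‖𝓕 (f 0) x‖ ^ 2
  have hgc : Continuous g := by
    have := (𝓕 (f 0)).continuous
    fun_prop
  have hshift : ∀ u x, 𝓕 (f u) x = Complex.exp (2 * Real.pi * u * x * Complex.I) * 𝓕 (f 0) x := by
    intro u x
    have := congrFun (VectorFourier.fourierIntegral_comp_add_right Real.fourierChar volume (innerₗ ℝ) (f 0) u) x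
    have e : (f u : ℝ → ℂ) = (f 0 : ℝ → ℂ) ∘ fun v => v + u := by
      ext v; simp [hf]
    rw [SchwartzMap.fourier_coe, SchwartzMap.fourier_coe, e]
    refine this.trans ?_
    rw [Circle.smul_def, smul_eq_mul]
    congr 1
    rw [Real.fourierChar_apply]
    simp
    ring_nf
  have hgInt : Integrable g := ((𝓕 (f 0)).memLp 2 volume).integrable_norm_pow (by norm_num)
  have hpl : ∀ u, ∫ x, Real.cos (2 * Real.pi * u * x) * g x = ∫ x, b x * b (x + u) := by
    intro u
    have := SchwartzMap.integral_inner_fourier_fourier (f 0) (f u)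
    have := congrArg Complex.re this
    have e1 : (∫ x, inner ℂ (f 0 x) (f u x)).re = ∫ x, b x * b (x + u) := by
      have : ∀ x, inner ℂ (f 0 x) (f u x) = ((b x * b (x + u) : ℝ) : ℂ) := by
        intro x; simp [hf, mul_comm]
      simp only [this]
      rw [integral_complex_ofReal, Complex.ofReal_re]
    have hI : Integrable fun x : ℝ => Complex.exp (2 * Real.pi * u * x * Complex.I) * (g x : ℂ) := by
      refine hgInt.mono' (by fun_prop) (Filter.Eventually.of_forall fun x => ?_)
      rw [norm_mul, show (2 * Real.pi * u * x * Complex.I : ℂ) = ((2 * Real.pi * u * x : ℝ) : ℂ) * Complex.I by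
        push_cast; ring, Complex.norm_exp_ofReal_mul_I, one_mul, Complex.norm_real,
        Real.norm_of_nonneg (by positivity : 0 ≤ g x)]
    have e2 : ∀ x, inner ℂ (𝓕 (f 0) x) (𝓕 (f u) x) = Complex.exp (2 * Real.pi * u * x * Complex.I) * (g x : ℂ) := by
      intro x
      rw [hshift u x, RCLike.inner_apply, mul_assoc, Complex.mul_conj, Complex.normSq_eq_norm_sq]
    rw [e1] at this
    rw [← this]
    simp only [e2]
    have e3 := integral_re (𝕜 := ℂ) hI
    refine Eq.trans ?_ e3
    congr 1 with x
    rw [RCLike.re_eq_complex_re, Complex.re_mul_ofReal, show (2 * Real.pi * u * x * Complex.I : ℂ) = ((2 * Real.pi * u * x : ℝ) : ℂ) * Complex.I by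
        push_cast; ring, Complex.exp_ofReal_mul_I_re]
  have hcosint : ∀ u, Integrable fun x => Real.cos (2 * Real.pi * u * x) * g x := by
    intro u
    refine hgInt.mono' (by fun_prop) (Filter.Eventually.of_forall fun x => ?_)
    rw [norm_mul, Real.norm_of_nonneg (by positivity : 0 ≤ g x)]
    exact mul_le_of_le_one_left (by positivity) (Real.abs_cos_le_one _)
  have hsym : ∀ u, ∫ x in Ioi (0:ℝ), Real.cos (2 * Real.pi * u * x) * (g x + g (-x)) = ∫ x, b x * b (x + u) := by
    intro u
    rw [← hpl, ← integral_add_compl (measurableSet_Ioi (a := (0:ℝ))) (hcosint u), compl_Ioi]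
    simp only [mul_add]
    have hi2 : Integrable fun x => Real.cos (2 * Real.pi * u * x) * g (-x) := by
      simpa using (hcosint u).comp_neg
    rw [integral_add (hcosint u).integrableOn hi2.integrableOn]
    congr 1
    have := integral_comp_neg_Ioi (0:ℝ) (fun x => Real.cos (2 * Real.pi * u * x) * g x)
    simpa using this
  refine ⟨fun x => g x + g (-x), by fun_prop, fun x => by positivity, (hgInt.add hgInt.comp_neg).integrableOn, ?_, ?_, ?_⟩
  · obtain ⟨C0, hC0, h0⟩ := (𝓕 (f 0)).decay 0 0
    obtain ⟨C1, hC1, h1⟩ := (𝓕 (f 0)).decay 2 0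
    simp only [norm_iteratedFDeriv_zero, pow_zero, one_mul] at h0 h1
    refine ⟨2 * C0 ^ 2 + 2 * C1 ^ 2, by positivity, fun p hp2 hp x hx => ?_⟩
    have hg0 : ∀ y, g y ≤ C0 ^ 2 := fun y => pow_le_pow_left₀ (norm_nonneg _) (h0 y) 2
    have hg1 : ∀ y, y ^ 4 * g y ≤ C1 ^ 2 := fun y => by
      have := pow_le_pow_left₀ (by positivity) (h1 y) 2
      rw [mul_pow, Real.norm_eq_abs, sq_abs, ← pow_mul] at this
      exact this
    rcases le_total x 1 with h | h
    · have : 1 ≤ x ^ (-1 - p) := Real.one_le_rpow_of_pos_of_le_one_of_nonpos hx h (by linarith)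
      have := hg0 x
      have := hg0 (-x)
      show g x + g (-x) ≤ _
      nlinarith [sq_nonneg C0, sq_nonneg C1]
    · have h3 : x ^ (-4 : ℝ) ≤ x ^ (-1 - p) := Real.rpow_le_rpow_of_exponent_le h (by linarith)
      have h4 : x ^ (-4 : ℝ) = (x ^ 4)⁻¹ := by
        rw [Real.rpow_neg hx.le]; norm_cast
      have e1 := hg1 x
      have e2 := hg1 (-x)
      rw [Even.neg_pow (by decide)] at e2
      have h5 : g x + g (-x) ≤ 2 * C1 ^ 2 * (x ^ 4)⁻¹ := by
        rw [← div_eq_mul_inv, le_div_iff₀ (by positivity)]; linarith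
      refine h5.trans ?_
      rw [← h4]
      have := Real.rpow_nonneg hx.le (-4:ℝ)
      nlinarith [sq_nonneg C0, sq_nonneg C1]
  · intro u hu
    rw [hsym]
    refine integral_eq_zero_of_ae (Filter.Eventually.of_forall fun x => ?_)
    show b x * b (x + u) = 0
    by_cases hx : |x| < 1/2
    · rw [b.zero_of_le_dist (x := x + u), mul_zero]
      show 1/2 ≤ dist (x+u) 0
      rw [Real.dist_eq, sub_zero]
      have := abs_sub_abs_le_abs_sub u (-x)
      rw [abs_neg, sub_neg_eq_add, add_comm u x] at this
      linarith
    · rw [b.zero_of_le_dist (x := x), zero_mul]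
      show 1/2 ≤ dist x 0
      rw [Real.dist_eq, sub_zero]; linarith
  · have := hsym 0
    simp only [mul_zero, zero_mul, Real.cos_zero, one_mul, add_zero] at this
    rw [this]
    have hbi : Integrable fun x => b x * b x :=
      (b.continuous.mul b.continuous).integrable_of_hasCompactSupport b.hasCompactSupport.mul_left
    rw [integral_pos_iff_support_of_nonneg (fun x => mul_self_nonneg _) hbi]
    refine lt_of_lt_of_le ?_ (measure_mono (s := Ioo (-1/4) (1/4)) ?_)
    · simp; norm_num
    · intro x hx
      have : b x = 1 := b.one_of_mem_closedBall (by
        show dist x 0 ≤ 1/4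
        rw [Real.dist_eq, sub_zero, abs_le]; constructor <;> linarith [hx.1, hx.2])
      simp [this]


lemma cos_form {ι : Type} [Fintype ι] (s w : ι → ℝ) (c x : ℝ) :
    0 ≤ ∑ i, ∑ j, w i * w j * Real.cos (c * (s i - s j) * x) := by
  have e : ∑ i, ∑ j, w i * w j * Real.cos (c * (s i - s j) * x) =
      (∑ i, w i * Real.cos (c * s i * x)) ^ 2 + (∑ i, w i * Real.sin (c * s i * x)) ^ 2 := by
    rw [sq, sq, Finset.sum_mul_sum, Finset.sum_mul_sum, ← Finset.sum_add_distrib]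
    refine Finset.sum_congr rfl fun i _ => ?_
    rw [← Finset.sum_add_distrib]
    refine Finset.sum_congr rfl fun j _ => ?_
    rw [show c * (s i - s j) * x = c * s i * x - c * s j * x by ring, Real.cos_sub]; ring
  rw [e]; positivity

lemma exists_h {p : ℝ} (hp : 0 < p) (hp2 : p < 2) : ∃ h : ℝ → ℝ, 0 < h 0 ∧
    (∀ u, 1 ≤ |u| → h u = 0) ∧ (∀ u, h (-u) = h u) ∧ PDf h ∧ CND (fun u => |u| ^ p + h u) := by
  obtain ⟨G, hGc, hG0, hGi, ⟨C, hC, hGC⟩, hGz, hGp⟩ := exists_spec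
  have hcos : ∀ x : ℝ, |1 - Real.cos x| ≤ 2 := fun x => by
    rw [abs_le]; constructor <;> linarith [Real.cos_le_one x, Real.neg_one_le_cos x]
  have hcos2 : ∀ x : ℝ, |1 - Real.cos x| ≤ x ^ 2 / 2 := fun x => by
    rw [abs_of_nonneg (by linarith [Real.cos_le_one x])]
    linarith [Real.one_sub_sq_div_two_le_cos (x := x)]
  have hi : ∀ v : ℝ, IntegrableOn (fun x => (1 - Real.cos (v * x)) * x ^ (-1 - p)) (Ioi 0) := fun v => by
    refine int_pow (F := fun x => 1 - Real.cos (v * x)) (by fun_prop) (A := v ^ 2 / 2) (B := 2) (m := 2) hp hp2 ?_ ?_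
    · intro x hx
      refine (hcos2 _).trans_eq ?_
      rw [Real.rpow_two]; ring
    · intro x hx; exact hcos _
  set c := ∫ x in Ioi (0:ℝ), (1 - Real.cos x) * x ^ (-1 - p) with hcdef
  have hc : 0 < c := by
    refine int_pow_pos (F := fun x => 1 - Real.cos x) (fun x _ => by linarith [Real.cos_le_one x])
      (y := 1) (z := 2) one_pos one_lt_two ?_ (by simpa using hi 1)
    intro x hx
    have : Real.cos x < Real.cos 0 :=
      Real.cos_lt_cos_of_nonneg_of_le_pi le_rfl (by linarith [hx.2, Real.pi_gt_three]) (by linarith [hx.1])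
    rw [Real.cos_zero] at this
    show 0 < 1 - Real.cos x
    linarith
  have hrep : ∀ u : ℝ, ∫ x in Ioi (0:ℝ), (1 - Real.cos (2 * Real.pi * u * x)) * x ^ (-1 - p)
      = ((2 * Real.pi) ^ p * c) * |u| ^ p := by
    intro u
    rcases eq_or_ne u 0 with rfl | hu
    · simp [Real.zero_rpow hp.ne']
    · have hu' : 0 < |u| := abs_pos.2 hu
      have := int_pow_scale (F := fun x => 1 - Real.cos x) (p := p) (u := 2 * Real.pi * |u|) (by positivity)
      rw [Real.mul_rpow (by positivity) (by positivity)] at this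
      rw [← hcdef] at this
      refine Eq.trans ?_ (this.trans (by ring))
      refine setIntegral_congr_fun measurableSet_Ioi fun x hx => ?_
      have hx : 0 < x := hx
      show (1 - Real.cos (2 * Real.pi * u * x)) * _ = (1 - Real.cos (2 * Real.pi * |u| * x)) * _
      rw [← Real.cos_abs (2 * Real.pi * u * x)]
      rw [abs_mul, abs_mul, abs_of_pos hx, abs_of_pos (by positivity : 0 < 2 * Real.pi)]
  set D := ((2 * Real.pi) ^ p * c)⁻¹ with hD
  have hDp : 0 < D := by positivity
  have hci : ∀ u : ℝ, IntegrableOn (fun x => Real.cos (2 * Real.pi * u * x) * G x) (Ioi 0) := by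
    intro u
    refine Integrable.mono' hGi (by fun_prop) (Filter.Eventually.of_forall fun x => ?_)
    rw [norm_mul, Real.norm_of_nonneg (hG0 x)]
    exact mul_le_of_le_one_left (hG0 x) (Real.abs_cos_le_one _)
  let h : ℝ → ℝ := fun u => D / C * ∫ x in Ioi (0:ℝ), Real.cos (2 * Real.pi * u * x) * G x
  have he : ∀ u, h (-u) = h u := by
    intro u
    simp only [h, mul_neg, neg_mul, Real.cos_neg]
  refine ⟨h, ?_, ?_, he, ?_, ?_⟩
  · have : 0 < D / C * ∫ x in Ioi (0:ℝ), G x := by positivity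
    simpa [h] using this
  · intro u hu
    simp only [h, hGz u hu, mul_zero]
  · intro ι _ s
    refine ⟨fun i j => ?_, fun w => ?_⟩
    · show h (s i - s j) = h (s j - s i)
      rw [← he, neg_sub]
    · have e : ∑ i, ∑ j, w i * w j * h (s i - s j) = ∫ x in Ioi (0:ℝ),
          ∑ i, ∑ j, w i * w j * (D / C * (Real.cos (2 * Real.pi * (s i - s j) * x) * G x)) := by
        rw [integral_finsetSum _ fun i _ => integrable_finsetSum _ fun j _ => ((hci _).const_mul _).const_mul _]
        refine Finset.sum_congr rfl fun i _ => ?_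
        rw [integral_finsetSum _ fun j _ => ((hci _).const_mul _).const_mul _]
        refine Finset.sum_congr rfl fun j _ => ?_
        rw [integral_const_mul, integral_const_mul]
      show 0 ≤ ∑ i, ∑ j, w i * w j * h (s i - s j)
      rw [e]
      refine setIntegral_nonneg measurableSet_Ioi fun x hx => ?_
      have := mul_nonneg (mul_nonneg (div_pos hDp hC).le (hG0 x)) (cos_form s w (2 * Real.pi) x)
      simp only [Finset.mul_sum] at this
      exact this.trans_eq (Finset.sum_congr rfl fun i _ => Finset.sum_congr rfl fun j _ => by ring)
  · intro ι _ s w hw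
    have hI : ∀ u, IntegrableOn (fun x => D * ((1 - Real.cos (2 * Real.pi * u * x)) * x ^ (-1 - p)) +
        D / C * (Real.cos (2 * Real.pi * u * x) * G x)) (Ioi 0) := fun u =>
      ((hi _).const_mul _).add ((hci u).const_mul _)
    have hR : ∀ u, |u| ^ p + h u = ∫ x in Ioi (0:ℝ), (D * ((1 - Real.cos (2 * Real.pi * u * x)) * x ^ (-1 - p)) +
        D / C * (Real.cos (2 * Real.pi * u * x) * G x)) := by
      intro u
      rw [integral_add ((hi _).const_mul _) ((hci u).const_mul _), integral_const_mul, integral_const_mul,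
        hrep, hD, inv_mul_cancel_left₀ (by positivity)]
    have e : ∑ i, ∑ j, w i * w j * (|s i - s j| ^ p + h (s i - s j)) = ∫ x in Ioi (0:ℝ),
          ∑ i, ∑ j, w i * w j * (D * ((1 - Real.cos (2 * Real.pi * (s i - s j) * x)) * x ^ (-1 - p)) +
        D / C * (Real.cos (2 * Real.pi * (s i - s j) * x) * G x)) := by
      rw [integral_finsetSum _ fun i _ => integrable_finsetSum _ fun j _ => (hI _).const_mul _]
      refine Finset.sum_congr rfl fun i _ => ?_
      rw [integral_finsetSum _ fun j _ => (hI _).const_mul _]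
      refine Finset.sum_congr rfl fun j _ => ?_
      rw [integral_const_mul, hR]
    show ∑ i, ∑ j, w i * w j * (|s i - s j| ^ p + h (s i - s j)) ≤ 0
    rw [e]
    refine setIntegral_nonpos measurableSet_Ioi fun x hx => ?_
    have hx : 0 < x := hx
    have h1 : 0 ≤ D * x ^ (-1 - p) - D / C * G x := by
      have := mul_le_mul_of_nonneg_left (hGC p hp2 hp x hx) (div_pos hDp hC).le
      rw [← mul_assoc, div_mul_cancel₀ _ hC.ne'] at this
      linarith
    have h2 := mul_nonneg h1 (cos_form s w (2 * Real.pi) x)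
    have z : ∑ i, ∑ j, w i * w j * (D * x ^ (-1 - p)) = 0 := by
      simp only [← Finset.sum_mul, ← Finset.mul_sum, hw]; simp
    have e2 : ∑ i, ∑ j, w i * w j * (D * ((1 - Real.cos (2 * Real.pi * (s i - s j) * x)) * x ^ (-1 - p)) +
        D / C * (Real.cos (2 * Real.pi * (s i - s j) * x) * G x)) =
        (∑ i, ∑ j, w i * w j * (D * x ^ (-1 - p))) - (D * x ^ (-1 - p) - D / C * G x) *
          ∑ i, ∑ j, w i * w j * Real.cos (2 * Real.pi * (s i - s j) * x) := by
      simp only [Finset.mul_sum]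
      rw [← Finset.sum_sub_distrib]
      refine Finset.sum_congr rfl fun i _ => ?_
      rw [← Finset.sum_sub_distrib]
      exact Finset.sum_congr rfl fun j _ => by ring
    rw [e2, z]; linarith

/-- scaled exponential bound with the rank-one correction -/
lemma form_lower {p : ℝ} (hp : 0 < p) {h : ℝ → ℝ}
    (hz : ∀ u, 1 ≤ |u| → h u = 0)
    (hhe : ∀ u, h (-u) = h u) (hh : PDf h) (hc : CND (fun u => |u| ^ p + h u))
    {ι : Type} [Fintype ι] (q w : ι → ℝ) (hq : ∀ i, 0 ≤ q i) (i0 : ι) (hw : w i0 = 1)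
    {r : ℝ} (hr : 0 < r) (hrt : r ≤ q i0)
    (hs : ∀ j, j ≠ i0 → r ≤ |q j - q i0|) {θ : ℝ} (hθ : 0 ≤ θ) :
    θ * r ^ p * Real.exp (-(θ * r ^ p) * h 0) * h 0 ≤
      ∑ i, ∑ j, w i * w j * (Real.exp (-(|q j - q i| ^ p * θ)) -
        Real.exp (-((q j ^ p + q i ^ p) * θ))) := by
  have h1 := exp_lower (ψ := fun u => |u| ^ p) (by simp [Real.zero_rpow hp.ne']) (by simp) hhe hh hc
    (fun o : Option ι => o.elim 0 (fun i => q i / r))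
    (fun o : Option ι => o.elim (-∑ i, w i * Real.exp (-(q i ^ p * θ))) w) (some i0) (by simpa using hw)
    (by
      intro j hj
      apply hz
      cases j with
      | none =>
        simp only [Option.elim, sub_zero]
        rw [abs_of_nonneg (by have := hq i0; positivity), le_div_iff₀ hr]; linarith
      | some j =>
        simp only [Option.elim]
        rw [← sub_div, abs_div, abs_of_pos hr, le_div_iff₀ hr, one_mul, abs_sub_comm]
        exact hs j (by simpa using hj)) (τ := θ * r ^ p) (by positivity)
  refine h1.trans_eq ?_
  have k1 : ∀ i j, -(θ * r ^ p) * |q i / r - q j / r| ^ p = -(|q j - q i| ^ p * θ) := by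
    intro i j
    rw [← sub_div, abs_div, abs_of_pos hr, Real.div_rpow (abs_nonneg _) hr.le, abs_sub_comm]
    have := (Real.rpow_pos_of_pos hr p).ne'
    field_simp
  have k2 : ∀ i, -(θ * r ^ p) * |q i / r| ^ p = -(q i ^ p * θ) := by
    intro i
    rw [abs_div, abs_of_pos hr, Real.div_rpow (abs_nonneg _) hr.le, abs_of_nonneg (hq i)]
    have := (Real.rpow_pos_of_pos hr p).ne'
    field_simp
  simp only [Fintype.sum_option, Option.elim, sub_zero, zero_sub, abs_neg, k1, k2, abs_zero,
    Real.zero_rpow hp.ne', mul_zero, Real.exp_zero]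
  set S := ∑ i, w i * Real.exp (-(q i ^ p * θ)) with hS
  have e : ∑ i, ∑ j, w i * w j * (Real.exp (-(|q j - q i| ^ p * θ)) -
        Real.exp (-((q j ^ p + q i ^ p) * θ))) =
      (∑ i, ∑ j, w i * w j * Real.exp (-(|q j - q i| ^ p * θ))) - S * S := by
    rw [hS, Finset.sum_mul_sum, ← Finset.sum_sub_distrib]
    refine Finset.sum_congr rfl fun i _ => ?_
    rw [← Finset.sum_sub_distrib]
    refine Finset.sum_congr rfl fun j _ => ?_
    rw [show -((q j ^ p + q i ^ p) * θ) = -(q i ^ p * θ) + -(q j ^ p * θ) by ring, Real.exp_add]; ring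
  have e1 : ∑ x, -S * w x * Real.exp (-(q x ^ p * θ)) = -S * S := by
    conv_rhs => rw [hS, Finset.mul_sum]
    exact Finset.sum_congr rfl fun j _ => by rw [hS]; ring
  have e2 : ∑ x, w x * -S * Real.exp (-(q x ^ p * θ)) = -S * S := by
    conv_rhs => rw [hS, Finset.mul_sum]
    exact Finset.sum_congr rfl fun j _ => by rw [hS]; ring
  rw [Finset.sum_add_distrib, e1, e2, e]
  ring

lemma core_lt {H K : ℝ} (hH : 0 < H) (hH1 : H < 1) (hK : 0 < K) (hK1 : K < 1) :
    ∃ c : ℝ, 0 < c ∧ ∀ (ι : Type) [Fintype ι] (q w : ι → ℝ), (∀ i, 0 ≤ q i) → ∀ i0, w i0 = 1 →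
      ∀ r, 0 < r → r ≤ q i0 → (∀ j, j ≠ i0 → r ≤ |q j - q i0|) →
      c * r ^ (2 * H * K) ≤ ∑ i, ∑ j, w i * w j * Rbif H K (q i) (q j) := by
  obtain ⟨h, h0, hz, hhe, hh, hc⟩ := exists_h (p := 2 * H) (by linarith) (by linarith)
  have hp : 0 < 2 * H := by linarith
  have hi : ∀ y : ℝ, 0 ≤ y → IntegrableOn (fun x => (1 - Real.exp (-(y * x))) * x ^ (-1 - K)) (Ioi 0) := by
    intro y hy
    have hb : ∀ x, 0 < x → |1 - Real.exp (-(y * x))| = 1 - Real.exp (-(y * x)) := fun x hx =>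
      abs_of_nonneg (by
        have : Real.exp (-(y * x)) ≤ 1 := Real.exp_le_one_iff.2 (by have := mul_nonneg hy hx.le; linarith)
        linarith)
    refine int_pow (F := fun x => 1 - Real.exp (-(y * x))) (by fun_prop) (A := y) (B := 1) (m := 1) hK hK1 ?_ ?_
    · intro x hx
      rw [hb x hx, Real.rpow_one]
      linarith [Real.add_one_le_exp (-(y * x))]
    · intro x hx
      rw [hb x hx]; linarith [Real.exp_pos (-(y * x))]
  set c := ∫ x in Ioi (0:ℝ), (1 - Real.exp (-x)) * x ^ (-1 - K) with hcdef
  have hcp : 0 < c := by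
    refine int_pow_pos (F := fun x => 1 - Real.exp (-x)) (fun x hx => ?_)
      (y := 1) (z := 2) one_pos one_lt_two ?_ (by simpa using hi 1 zero_le_one)
    · have := Real.exp_le_one_iff.2 (by linarith : -x ≤ 0)
      show 0 ≤ 1 - Real.exp (-x)
      linarith
    · intro x hx
      have := Real.exp_lt_one_iff.2 (by linarith [hx.1] : -x < 0)
      show 0 < 1 - Real.exp (-x)
      linarith
  have hrep : ∀ y : ℝ, 0 ≤ y → y ^ K * c = ∫ x in Ioi (0:ℝ), (1 - Real.exp (-(y * x))) * x ^ (-1 - K) := by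
    intro y hy
    rcases hy.eq_or_lt with rfl | hy
    · simp [Real.zero_rpow hK.ne']
    · exact (int_pow_scale (F := fun x => 1 - Real.exp (-x)) (p := K) hy).symm
  set δ := Real.exp (-2 * h 0) * h 0 with hδ
  have hδp : 0 < δ := by positivity
  set J := ∫ x in Ioc (1:ℝ) 2, x ^ (-1 - K) with hJ
  have hJp : 0 < J := by
    rw [hJ, ← intervalIntegral.integral_of_le one_le_two]
    refine intervalIntegral.intervalIntegral_pos_of_pos_on ?_ (fun x hx => Real.rpow_pos_of_pos (by linarith [hx.1]) _) one_lt_two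
    refine intervalIntegral.intervalIntegrable_rpow (Or.inr ?_)
    rw [uIcc_of_le one_le_two]; intro hx; linarith [hx.1]
  refine ⟨(2:ℝ) ^ (-K) * c⁻¹ * (δ * J), by positivity, ?_⟩
  intro ι _ q w hq i0 hw r hr hrt hs
  let Q : ℝ → ℝ := fun θ => ∑ i, ∑ j, w i * w j * (Real.exp (-(|q j - q i| ^ (2 * H) * θ)) -
        Real.exp (-((q j ^ (2 * H) + q i ^ (2 * H)) * θ)))
  have hQ : ∀ θ, 0 ≤ θ → θ * r ^ (2 * H) * Real.exp (-(θ * r ^ (2 * H)) * h 0) * h 0 ≤ Q θ := fun θ hθ =>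
    form_lower hp hz hhe hh hc q w hq i0 hw hr hrt hs hθ
  have hn : ∀ i j, 0 ≤ q j ^ (2 * H) + q i ^ (2 * H) := fun i j =>
    add_nonneg (Real.rpow_nonneg (hq j) _) (Real.rpow_nonneg (hq i) _)
  have hm : ∀ i j, 0 ≤ |q j - q i| ^ (2 * H) := fun i j => Real.rpow_nonneg (abs_nonneg _) _
  have hI : ∀ i j, IntegrableOn (fun θ => (Real.exp (-(|q j - q i| ^ (2 * H) * θ)) -
        Real.exp (-((q j ^ (2 * H) + q i ^ (2 * H)) * θ))) * θ ^ (-1 - K)) (Ioi 0) := by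
    intro i j
    refine ((hi _ (hn i j)).sub (hi _ (hm i j))).congr (Filter.Eventually.of_forall fun x => ?_)
    simp only [Pi.sub_apply]; ring
  have hR : ∀ i j, Rbif H K (q i) (q j) = (2:ℝ) ^ (-K) * c⁻¹ * ∫ θ in Ioi (0:ℝ),
      (Real.exp (-(|q j - q i| ^ (2 * H) * θ)) -
        Real.exp (-((q j ^ (2 * H) + q i ^ (2 * H)) * θ))) * θ ^ (-1 - K) := by
    intro i j
    have : ∫ θ in Ioi (0:ℝ), (Real.exp (-(|q j - q i| ^ (2 * H) * θ)) -
        Real.exp (-((q j ^ (2 * H) + q i ^ (2 * H)) * θ))) * θ ^ (-1 - K) =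
        (q j ^ (2 * H) + q i ^ (2 * H)) ^ K * c - (|q j - q i| ^ (2 * H)) ^ K * c := by
      rw [hrep _ (hn i j), hrep _ (hm i j), ← integral_sub (hi _ (hn i j)) (hi _ (hm i j))]
      congr 1 with x; ring
    rw [this, ← sub_mul, ← Real.rpow_mul (abs_nonneg _), Rbif]
    field_simp
  have hQe : (fun θ => Q θ * θ ^ (-1 - K)) = fun θ => ∑ i, ∑ j, w i * w j * ((Real.exp (-(|q j - q i| ^ (2 * H) * θ)) -
        Real.exp (-((q j ^ (2 * H) + q i ^ (2 * H)) * θ))) * θ ^ (-1 - K)) := by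
    funext θ
    simp only [Q, Finset.sum_mul, mul_assoc]
  have hQi : IntegrableOn (fun θ => Q θ * θ ^ (-1 - K)) (Ioi 0) := by
    rw [hQe]
    exact integrable_finsetSum _ fun i _ => integrable_finsetSum _ fun j _ => (hI i j).const_mul _
  have hS : ∑ i, ∑ j, w i * w j * Rbif H K (q i) (q j) = (2:ℝ) ^ (-K) * c⁻¹ *
      ∫ θ in Ioi (0:ℝ), Q θ * θ ^ (-1 - K) := by
    rw [hQe, integral_finsetSum _ fun i _ => integrable_finsetSum _ fun j _ => (hI i j).const_mul _, Finset.mul_sum]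
    refine Finset.sum_congr rfl fun i _ => ?_
    rw [integral_finsetSum _ fun j _ => (hI i j).const_mul _, Finset.mul_sum]
    refine Finset.sum_congr rfl fun j _ => ?_
    rw [integral_const_mul, hR]; ring
  rw [hS, mul_assoc ((2:ℝ) ^ (-K) * c⁻¹)]
  refine mul_le_mul_of_nonneg_left ?_ (by positivity)
  have hrp : 0 < r ^ (2 * H) := Real.rpow_pos_of_pos hr _
  -- rescale
  have hsc := int_pow_scale (F := Q) (p := K) (u := (r ^ (2 * H))⁻¹) (by positivity)
  have hrr : r ^ (2 * H * K) * ((r ^ (2 * H))⁻¹) ^ K = 1 := by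
    rw [Real.inv_rpow hrp.le, ← Real.rpow_mul hr.le]
    exact mul_inv_cancel₀ (Real.rpow_pos_of_pos hr _).ne'
  have hfin : ∫ θ in Ioi (0:ℝ), Q θ * θ ^ (-1 - K) = r ^ (2 * H * K) *
      ∫ x in Ioi (0:ℝ), Q ((r ^ (2 * H))⁻¹ * x) * x ^ (-1 - K) := by
    rw [hsc, ← mul_assoc, hrr, one_mul]
  rw [hfin, mul_comm]
  refine mul_le_mul_of_nonneg_left ?_ (Real.rpow_nonneg hr.le _)
  have hQInt2 : IntegrableOn (fun x => Q ((r ^ (2 * H))⁻¹ * x) * x ^ (-1 - K)) (Ioi 0) := by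
    have := (integrableOn_Ioi_comp_mul_left_iff (fun θ => Q θ * θ ^ (-1 - K)) 0 (a := (r ^ (2 * H))⁻¹) (by positivity)).2
      (by simpa using hQi)
    refine IntegrableOn.congr_fun (this.const_mul (((r ^ (2 * H))⁻¹) ^ (1 + K))) (fun x hx => ?_) measurableSet_Ioi
    have hx : 0 < x := hx
    have hrv : 0 < (r ^ (2 * H))⁻¹ := by positivity
    rw [Real.mul_rpow hrv.le hx.le, show -1 - K = -(1 + K) by ring, Real.rpow_neg hrv.le]
    have := (Real.rpow_pos_of_pos hrv (1 + K)).ne'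
    field_simp
  have hQ2 : ∀ x, 0 ≤ x → x * Real.exp (-x * h 0) * h 0 ≤ Q ((r ^ (2 * H))⁻¹ * x) := by
    intro x hx
    have := hQ ((r ^ (2 * H))⁻¹ * x) (by positivity)
    rwa [show (r ^ (2 * H))⁻¹ * x * r ^ (2 * H) = x by field_simp] at this
  calc δ * J = ∫ x in Ioc (1:ℝ) 2, δ * x ^ (-1 - K) := by rw [integral_const_mul]
    _ ≤ ∫ x in Ioc (1:ℝ) 2, Q ((r ^ (2 * H))⁻¹ * x) * x ^ (-1 - K) := by
      refine setIntegral_mono_on ?_ (hQInt2.mono_set ?_) measurableSet_Ioc ?_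
      · by_contra hne
        have : J = 0 := by
          rw [hJ]; apply integral_undef
          intro hh; exact hne (hh.const_mul δ)
        exact hJp.ne' this
      · intro x hx; exact one_pos.trans hx.1
      · intro x hx
        have hx0 : 0 < x := one_pos.trans hx.1
        refine mul_le_mul_of_nonneg_right ?_ (Real.rpow_nonneg hx0.le _)
        refine le_trans ?_ (hQ2 x hx0.le)
        refine mul_le_mul_of_nonneg_right ?_ h0.le
        have e1 : Real.exp (-2 * h 0) ≤ Real.exp (-x * h 0) :=
          Real.exp_le_exp.2 (by nlinarith [hx.2])
        have := Real.exp_pos (-x * h 0)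
        nlinarith [hx.1]
    _ ≤ _ := by
      refine setIntegral_mono_set hQInt2 ?_ (Filter.Eventually.of_forall fun x hx => one_pos.trans hx.1)
      refine (ae_restrict_iff' measurableSet_Ioi).2 (Filter.Eventually.of_forall fun x hx => ?_)
      have hx : 0 < x := hx
      exact mul_nonneg (le_trans (by positivity) (hQ2 x hx.le)) (Real.rpow_nonneg hx.le _)

lemma core_one {H : ℝ} (hH : 0 < H) (hH1 : H < 1) :
    ∃ c : ℝ, 0 < c ∧ ∀ (ι : Type) [Fintype ι] (q w : ι → ℝ), (∀ i, 0 ≤ q i) → ∀ i0, w i0 = 1 →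
      ∀ r, 0 < r → r ≤ q i0 → (∀ j, j ≠ i0 → r ≤ |q j - q i0|) →
      c * r ^ (2 * H * 1) ≤ ∑ i, ∑ j, w i * w j * Rbif H 1 (q i) (q j) := by
  obtain ⟨h, h0, hz, hhe, hh, hc⟩ := exists_h (p := 2 * H) (by linarith) (by linarith)
  have hp : 0 < 2 * H := by linarith
  refine ⟨h 0 / 2, by positivity, ?_⟩
  intro ι _ q w hq i0 hw r hr hrt hs
  let P : Option ι → ℝ := fun o => o.elim 0 (fun i => q i / r)
  let W : Option ι → ℝ := fun o => o.elim (-∑ i, w i) w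
  have h1 := hc (Option ι) P W (by simp [W, Fintype.sum_option])
  have h2 := (hh (Option ι) P).isolated (some i0)
    (by
      intro j hj
      apply hz
      cases j with
      | none =>
        simp only [P, Option.elim, sub_zero]
        rw [abs_of_nonneg (by have := hq i0; positivity), le_div_iff₀ hr]; linarith
      | some j =>
        simp only [P, Option.elim]
        rw [← sub_div, abs_div, abs_of_pos hr, le_div_iff₀ hr, one_mul, abs_sub_comm]
        exact hs j (by simpa using hj)) W (by simpa [W] using hw)
  simp only [sub_self] at h2
  have hrp : 0 < r ^ (2 * H) := Real.rpow_pos_of_pos hr _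
  have k1 : ∀ i j, |q i / r - q j / r| ^ (2 * H) = (r ^ (2 * H))⁻¹ * |q j - q i| ^ (2 * H) := by
    intro i j
    rw [← sub_div, abs_div, abs_of_pos hr, Real.div_rpow (abs_nonneg _) hr.le, abs_sub_comm, div_eq_inv_mul]
  have k2 : ∀ i, |q i / r| ^ (2 * H) = (r ^ (2 * H))⁻¹ * q i ^ (2 * H) := by
    intro i
    rw [abs_div, abs_of_pos hr, Real.div_rpow (abs_nonneg _) hr.le, abs_of_nonneg (hq i), div_eq_inv_mul]
  have h3 : ∑ i, ∑ j, W i * W j * |P i - P j| ^ (2 * H) ≤ - h 0 := by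
    simp only [mul_add, Finset.sum_add_distrib] at h1
    linarith
  have h4 : ∑ i, ∑ j, W i * W j * |P i - P j| ^ (2 * H) =
      -(2 * (r ^ (2 * H))⁻¹) * ∑ i, ∑ j, w i * w j * Rbif H 1 (q i) (q j) := by
    simp only [W, P, Fintype.sum_option, Option.elim, sub_zero, zero_sub, abs_neg, k1, k2, abs_zero,
      Real.zero_rpow hp.ne', mul_zero]
    set S := ∑ i, w i * q i ^ (2 * H) with hS
    set T := ∑ i, w i with hT
    have e1 : ∑ x, -T * w x * ((r ^ (2 * H))⁻¹ * q x ^ (2 * H)) = -(r ^ (2 * H))⁻¹ * (T * S) := by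
      rw [hS, Finset.mul_sum, Finset.mul_sum]
      exact Finset.sum_congr rfl fun j _ => by ring
    have e2 : ∑ x, w x * -T * ((r ^ (2 * H))⁻¹ * q x ^ (2 * H)) = -(r ^ (2 * H))⁻¹ * (T * S) := by
      rw [hS, Finset.mul_sum, Finset.mul_sum]
      exact Finset.sum_congr rfl fun j _ => by ring
    have e3 : ∑ i, ∑ j, w i * w j * Rbif H 1 (q i) (q j) = 1 / 2 * (T * S + S * T -
        ∑ i, ∑ j, w i * w j * |q j - q i| ^ (2 * H)) := by
      rw [hS, hT, Finset.sum_mul_sum, Finset.sum_mul_sum, ← Finset.sum_add_distrib, ← Finset.sum_sub_distrib,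
        Finset.mul_sum]
      refine Finset.sum_congr rfl fun i _ => ?_
      rw [← Finset.sum_add_distrib, ← Finset.sum_sub_distrib, Finset.mul_sum]
      refine Finset.sum_congr rfl fun j _ => ?_
      rw [Rbif, Real.rpow_one, mul_one, Real.rpow_neg_one]; ring
    have e4 : ∑ i, ∑ j, w i * w j * ((r ^ (2 * H))⁻¹ * |q j - q i| ^ (2 * H)) = (r ^ (2 * H))⁻¹ *
        ∑ i, ∑ j, w i * w j * |q j - q i| ^ (2 * H) := by
      simp only [Finset.mul_sum]
      exact Finset.sum_congr rfl fun i _ => Finset.sum_congr rfl fun j _ => by ring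
    rw [Finset.sum_add_distrib, e1, e2, e3, e4]
    ring
  rw [h4] at h3
  have := mul_le_mul_of_nonneg_left h3 hrp.le
  rw [show r ^ (2 * H) * (-(2 * (r ^ (2 * H))⁻¹) * ∑ i, ∑ j, w i * w j * Rbif H 1 (q i) (q j)) =
    -2 * ∑ i, ∑ j, w i * w j * Rbif H 1 (q i) (q j) by field_simp] at this
  rw [mul_one]
  linarith

lemma Rbif_symm (H K s t : ℝ) : Rbif H K s t = Rbif H K t s := by
  rw [Rbif, Rbif, abs_sub_comm, add_comm]

end BifAux

/-- Proposition 2.1: strong local `φ`-nondeterminism of the bifractional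
Brownian motion `B₀^{H,K}` on `[a,b]` with `φ(r) = r^{2HK}`, stated via the covariance:
there are `c > 0` and `r₀ > 0` such that for all `t ∈ [a,b]`, `0 < r ≤ min{t, r₀}`,
all finitely many points `s₁, …, s_n ∈ [a,b]` with `r ≤ |s_i - t| ≤ r₀` and all reals
`a₁, …, a_n`,
`R(t,t) - 2 ∑ᵢ aᵢ R(sᵢ,t) + ∑ᵢ ∑ⱼ aᵢ aⱼ R(sᵢ,sⱼ) ≥ c r^{2HK}`;
the left-hand side equals `Var(B₀^{H,K}(t) ∣ B₀^{H,K}(s₁), …, B₀^{H,K}(s_n))`'s defining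
quadratic form `E[(B₀^{H,K}(t) - ∑ᵢ aᵢ B₀^{H,K}(sᵢ))²]`. -/
theorem bifBM_strong_local_nondeterminism (H K a b : ℝ)
    (hH : H ∈ Set.Ioo (0:ℝ) 1) (hK : K ∈ Set.Ioc (0:ℝ) 1)
    (ha : 0 < a) (hab : a < b) :
    ∃ c r₀ : ℝ, 0 < c ∧ 0 < r₀ ∧
      ∀ t ∈ Set.Icc a b, ∀ r : ℝ, 0 < r → r ≤ min t r₀ →
        ∀ (n : ℕ) (s : Fin n → ℝ) (α : Fin n → ℝ),
          (∀ i, s i ∈ Set.Icc a b ∧ r ≤ |s i - t| ∧ |s i - t| ≤ r₀) →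
          c * r ^ (2 * H * K) ≤
            Rbif H K t t - 2 * ∑ i, α i * Rbif H K (s i) t +
              ∑ i, ∑ j, α i * α j * Rbif H K (s i) (s j) := by
  obtain ⟨hH0, hH1⟩ := hH
  obtain ⟨hK0, hK1⟩ := hK
  have hcore : ∃ c : ℝ, 0 < c ∧ ∀ (ι : Type) [Fintype ι] (q w : ι → ℝ), (∀ i, 0 ≤ q i) → ∀ i0, w i0 = 1 →
      ∀ r, 0 < r → r ≤ q i0 → (∀ j, j ≠ i0 → r ≤ |q j - q i0|) →
      c * r ^ (2 * H * K) ≤ ∑ i, ∑ j, w i * w j * Rbif H K (q i) (q j) := by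
    rcases hK1.eq_or_lt with rfl | hK1
    · exact core_one hH0 hH1
    · exact core_lt hH0 hH1 hK0 hK1
  obtain ⟨c, hc, hcore⟩ := hcore
  refine ⟨c, 1, hc, one_pos, ?_⟩
  intro t ht r hr hrt n s α hs
  have := hcore (Option (Fin n)) (fun o => o.elim t s) (fun o => o.elim 1 (fun i => -α i))
    (by
      intro i
      cases i with
      | none => exact ha.le.trans ht.1
      | some i => exact ha.le.trans (hs i).1.1)
    none rfl r hr (hrt.trans (min_le_left _ _))
    (by
      intro j hj
      cases j with
      | none => exact absurd rfl hj
      | some j => exact (hs j).2.1)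
  refine this.trans_eq ?_
  simp only [Fintype.sum_option, Option.elim, Finset.sum_add_distrib]
  have e1 : ∑ x, 1 * -α x * Rbif H K t (s x) = -∑ i, α i * Rbif H K (s i) t := by
    rw [← Finset.sum_neg_distrib]
    exact Finset.sum_congr rfl fun j _ => by rw [Rbif_symm]; ring
  have e2 : ∑ x, -α x * 1 * Rbif H K (s x) t = -∑ i, α i * Rbif H K (s i) t := by
    rw [← Finset.sum_neg_distrib]
    exact Finset.sum_congr rfl fun j _ => by ring
  rw [e1, e2]
  simp only [neg_mul_neg]
  ring
end

section
/- Let H ∈ (0,1), K ∈ (0,1], let r : ℝ → ℝ be the even function with r(t) = 2^{-K} e^{HK t}[(1 + e^{-2Ht})^K − (1 − e^{-t})^{2HK}] for t ≥ 0, and define the spectral density f(λ) = (1/π) ∫₀^∞ r(t) cos(tλ) dt. Then there exist positive constants c₅ and c₆ such that for all u > 1: (i) ∫_{|λ| < u} λ² f(λ) dλ ≤ c₅ u^{2(1−HK)}, and (ii) ∫_{|λ| ≥ u} f(λ) dλ ≤ c₆ u^{−2HK} (in particular this integral is finite). -/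
open MeasureTheory

/-- The covariance function `r(t)` of the stationary (Lamperti-transformed) Gaussian process
associated with the bifractional Brownian motion, extended evenly. -/
noncomputable def rcov (H K t : ℝ) : ℝ :=
  (2 : ℝ) ^ (-K) * Real.exp (H * K * |t|) *
    ((1 + Real.exp (-2 * H * |t|)) ^ K - (1 - Real.exp (-|t|)) ^ (2 * H * K))

/-- The spectral density `f(λ) = (1/π) ∫₀^∞ r(t) cos(tλ) dt`. -/
noncomputable def specDensity (H K lam : ℝ) : ℝ :=
  (1 / Real.pi) * ∫ t in Set.Ioi (0 : ℝ), rcov H K t * Real.cos (t * lam)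




lemma sd_general (r0 r1 r2 r3 : ℝ → ℝ) (a C δ : ℝ) (ha : 0 < a) (ha2 : a < 2) (hC : 0 < C)
    (hδ : 0 < δ) (hc : ContinuousOn r0 (Set.Ici 0))
    (hd0 : ∀ t, 0 < t → HasDerivAt r0 (r1 t) t)
    (hd1 : ∀ t, 0 < t → HasDerivAt r1 (r2 t) t)
    (hd2 : ∀ t, 0 < t → HasDerivAt r2 (r3 t) t)
    (hc3 : ContinuousOn r3 (Set.Ioi 0))
    (hrint : IntegrableOn r0 (Set.Ioi 0))
    (l0 : Filter.Tendsto r0 Filter.atTop (nhds 0))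
    (l1 : Filter.Tendsto r1 Filter.atTop (nhds 0))
    (l2 : Filter.Tendsto r2 Filter.atTop (nhds 0))
    (b1 : ∀ t, 0 < t → t ≤ 1 → |r1 t| ≤ C * t ^ (a - 1))
    (b2 : ∀ t, 0 < t → t ≤ 1 → |r2 t| ≤ C * t ^ (a - 2))
    (b3 : ∀ t, 0 < t → |r3 t| ≤ C * (t ^ (a - 3) + Real.exp (-δ * t))) :
    ∃ M, 0 < M ∧ ∀ l : ℝ, 1 ≤ l →
      |∫ t in Set.Ioi (0:ℝ), r0 t * Real.cos (t * l)| ≤ M * l ^ (-1 - a) := by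
  refine ⟨C * (1 / a + 1 + 1 + (1 / (2 - a) + 1 / δ)), ?_, ?_⟩
  · have : 0 < 2 - a := by linarith
    positivity
  intro l hl
  have hl0 : 0 < l := by linarith
  obtain ⟨e, he⟩ : ∃ e, e = l⁻¹ := ⟨_, rfl⟩
  have hle : l = e⁻¹ := by rw [he, inv_inv]
  have he0 : 0 < e := by rw [he]; positivity
  have he1 : e ≤ 1 := by rw [he]; exact inv_le_one_of_one_le₀ hl
  have hel : e * l = 1 := by rw [he]; field_simp
  have hpow : l ^ (-1 - a) = e ^ (1 + a) := by
    rw [hle, Real.inv_rpow he0.le, ← Real.rpow_neg he0.le]; congr 1; ring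
  rw [hpow]
  -- integrability
  have hI : IntegrableOn (fun t => r0 t * Real.cos (t * l)) (Set.Ioi 0) := by
    refine Integrable.mono hrint ?_ ?_
    · exact hrint.aestronglyMeasurable.mul (by fun_prop : Continuous fun t : ℝ => Real.cos (t * l)).aestronglyMeasurable
    · refine Filter.Eventually.of_forall fun t => ?_
      rw [norm_mul]
      exact mul_le_of_le_one_right (norm_nonneg _) (Real.abs_cos_le_one _)
  have hsplit : ∫ t in Set.Ioi (0:ℝ), r0 t * Real.cos (t * l)
      = (∫ t in (0:ℝ)..e, r0 t * Real.cos (t * l)) + ∫ t in Set.Ioi e, r0 t * Real.cos (t * l) := by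
    rw [intervalIntegral.integral_of_le he0.le, ← Set.Ioc_union_Ioi_eq_Ioi he0.le]
    rw [setIntegral_union Set.Ioc_disjoint_Ioi_same measurableSet_Ioi]
    · exact hI.mono_set Set.Ioc_subset_Ioi_self
    · exact hI.mono_set (Set.Ioi_subset_Ioi he0.le)
  -- near zero
  have hp1 : IntervalIntegrable (fun t : ℝ => C * t ^ (a - 1)) volume 0 e :=
    (intervalIntegral.intervalIntegrable_rpow' (by linarith)).const_mul C
  have hr1c : ContinuousOn r1 (Set.Ioi 0) := fun t ht => (hd1 t ht).continuousAt.continuousWithinAt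
  have hI1 : IntervalIntegrable (fun t => r1 t * Real.sin (t * l)) volume 0 e := by
    rw [intervalIntegrable_iff_integrableOn_Ioc_of_le he0.le] at hp1 ⊢
    refine Integrable.mono' hp1 ?_ ?_
    · exact (ContinuousOn.mul (hr1c.mono Set.Ioc_subset_Ioi_self) (by fun_prop)).aestronglyMeasurable measurableSet_Ioc
    · refine (ae_restrict_iff' measurableSet_Ioc).2 (Filter.Eventually.of_forall fun t ht => ?_)
      rw [norm_mul]
      exact (mul_le_of_le_one_right (norm_nonneg _) (Real.abs_sin_le_one _)).trans (b1 t ht.1 (ht.2.trans he1))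
  have hB1 : |∫ t in (0:ℝ)..e, r1 t * Real.sin (t * l)| ≤ C * (e ^ a / a) := by
    have h := intervalIntegral.norm_integral_le_of_norm_le (f := fun t => r1 t * Real.sin (t * l)) he0.le (Filter.Eventually.of_forall fun t ht => by
      rw [norm_mul]
      exact (mul_le_of_le_one_right (norm_nonneg _) (Real.abs_sin_le_one _)).trans (b1 t ht.1 (ht.2.trans he1))) hp1
    rw [intervalIntegral.integral_const_mul, integral_rpow (Or.inl (by linarith))] at h
    rw [sub_add_cancel, Real.zero_rpow ha.ne', sub_zero] at h
    exact h
  have hIc : IntervalIntegrable (fun t => r0 t * Real.cos (t * l)) volume 0 e := by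
    rw [intervalIntegrable_iff_integrableOn_Ioc_of_le he0.le]
    exact hI.mono_set Set.Ioc_subset_Ioi_self
  have hF1 : (∫ t in (0:ℝ)..e, r0 t * Real.cos (t * l)) = e * (r0 e * Real.sin 1)
      - e * ∫ t in (0:ℝ)..e, r1 t * Real.sin (t * l) := by
    have h := intervalIntegral.integral_eq_sub_of_hasDerivAt_of_le (a := 0) (b := e)
      (f := fun t => e * (r0 t * Real.sin (t * l)))
      (f' := fun t => e * (r1 t * Real.sin (t * l)) + r0 t * Real.cos (t * l)) he0.le
      (by
        have : ContinuousOn r0 (Set.Icc 0 e) := hc.mono Set.Icc_subset_Ici_self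
        fun_prop)
      (fun t ht => by
        have h1 := ((hd0 t ht.1).mul ((hasDerivAt_id t).mul_const l).sin).const_mul e
        refine HasDerivAt.congr_deriv (h1) ?_
        simp only [id]
        symm
        linear_combination (-(r0 t * Real.cos (t * l))) * hel)
      ((hI1.const_mul e).add hIc)
    rw [intervalIntegral.integral_add (hI1.const_mul e) hIc, intervalIntegral.integral_const_mul] at h
    rw [hel] at h
    simp at h
    linarith
  -- tail
  have hp3 : IntegrableOn (fun t : ℝ => C * (t ^ (a - 3) + Real.exp (-δ * t))) (Set.Ioi e) :=
    ((integrableOn_Ioi_rpow_of_lt (by linarith) he0).add (exp_neg_integrableOn_Ioi e hδ)).const_mul C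
  have hb3 : ∀ t ∈ Set.Ioi e, ‖r3 t * Real.sin (t * l)‖ ≤ C * (t ^ (a - 3) + Real.exp (-δ * t)) := by
    intro t ht
    rw [norm_mul]
    exact (mul_le_of_le_one_right (norm_nonneg _) (Real.abs_sin_le_one _)).trans (b3 t (he0.trans ht))
  have hI3 : IntegrableOn (fun t => r3 t * Real.sin (t * l)) (Set.Ioi e) := by
    refine Integrable.mono' hp3 ?_ ((ae_restrict_iff' measurableSet_Ioi).2 (Filter.Eventually.of_forall hb3))
    exact (ContinuousOn.mul (hc3.mono (Set.Ioi_subset_Ioi he0.le)) (by fun_prop)).aestronglyMeasurable measurableSet_Ioi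
  have hB3 : |∫ t in Set.Ioi e, r3 t * Real.sin (t * l)| ≤ C * (e ^ (a - 2) / (2 - a) + 1 / δ) := by
    have h := norm_integral_le_of_norm_le hp3 ((ae_restrict_iff' measurableSet_Ioi).2 (Filter.Eventually.of_forall hb3))
    rw [integral_const_mul, integral_add (integrableOn_Ioi_rpow_of_lt (by linarith) he0) (exp_neg_integrableOn_Ioi e hδ),
      integral_Ioi_rpow_of_lt (by linarith) he0, integral_exp_mul_Ioi (by linarith)] at h
    refine h.trans ?_
    have e1 : -e ^ (a - 3 + 1) / (a - 3 + 1) = e ^ (a - 2) / (2 - a) := by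
      rw [show a - 3 + 1 = -(2 - a) by ring, neg_div_neg_eq, show -(2 - a) = a - 2 by ring]
    have e2 : -Real.exp (-δ * e) / -δ ≤ 1 / δ := by
      rw [neg_div_neg_eq]
      gcongr
      rw [Real.exp_le_one_iff]
      nlinarith
    rw [e1]
    gcongr
  have hIe := hI.mono_set (Set.Ioi_subset_Ioi he0.le)
  have hbd : ∀ (g w : ℝ → ℝ), Filter.Tendsto g Filter.atTop (nhds 0) → (∀ t, |w t| ≤ 1) →
      Filter.Tendsto (fun t => g t * w t) Filter.atTop (nhds 0) := by
    intro g w hg hw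
    refine squeeze_zero_norm (a := fun t => |g t|) (fun t => ?_) (by simpa using hg.abs)
    rw [norm_mul]
    exact mul_le_of_le_one_right (norm_nonneg _) (hw t)
  have hF2 : (∫ t in Set.Ioi e, r0 t * Real.cos (t * l)) = e ^ 3 * (∫ t in Set.Ioi e, r3 t * Real.sin (t * l))
      - (e * (r0 e * Real.sin 1) + e ^ 2 * (r1 e * Real.cos 1) - e ^ 3 * (r2 e * Real.sin 1)) := by
    have hder : ∀ t ∈ Set.Ici e, HasDerivAt (fun t => e * (r0 t * Real.sin (t * l)) + e ^ 2 * (r1 t * Real.cos (t * l))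
          - e ^ 3 * (r2 t * Real.sin (t * l))) (r0 t * Real.cos (t * l) - e ^ 3 * (r3 t * Real.sin (t * l))) t := by
      intro t ht
      have ht0 : 0 < t := he0.trans_le ht
      have h0 := ((hd0 t ht0).mul ((hasDerivAt_id t).mul_const l).sin).const_mul e
      have h1 := ((hd1 t ht0).mul ((hasDerivAt_id t).mul_const l).cos).const_mul (e ^ 2)
      have h2 := ((hd2 t ht0).mul ((hasDerivAt_id t).mul_const l).sin).const_mul (e ^ 3)
      refine HasDerivAt.congr_deriv ((h0.add h1).sub h2) ?_
      simp only [id]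
      symm
      linear_combination (-(r0 t * Real.cos (t * l)) + e * r1 t * Real.sin (t * l) + e ^ 2 * r2 t * Real.cos (t * l)) * hel
    have hlim : Filter.Tendsto (fun t => e * (r0 t * Real.sin (t * l)) + e ^ 2 * (r1 t * Real.cos (t * l))
          - e ^ 3 * (r2 t * Real.sin (t * l))) Filter.atTop (nhds 0) := by
      have h0 := (hbd r0 (fun t => Real.sin (t * l)) l0 (fun t => Real.abs_sin_le_one _)).const_mul e
      have h1 := (hbd r1 (fun t => Real.cos (t * l)) l1 (fun t => Real.abs_cos_le_one _)).const_mul (e ^ 2)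
      have h2 := (hbd r2 (fun t => Real.sin (t * l)) l2 (fun t => Real.abs_sin_le_one _)).const_mul (e ^ 3)
      simpa using (h0.add h1).sub h2
    have h := integral_Ioi_of_hasDerivAt_of_tendsto' hder (hIe.sub (hI3.const_mul (e ^ 3))) hlim
    rw [integral_sub hIe (hI3.const_mul (e ^ 3)), integral_const_mul] at h
    simp only [hel] at h
    linarith
  have q1 := b1 e he0 he1
  have q2 := b2 e he0 he1
  have p1 : e * e ^ a = e ^ (1 + a) := by rw [Real.rpow_add he0, Real.rpow_one]
  have p2 : e ^ 2 * e ^ (a - 1) = e ^ (1 + a) := by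
    rw [← Real.rpow_natCast e 2, ← Real.rpow_add he0]; congr 1; push_cast; ring
  have p3 : e ^ 3 * e ^ (a - 2) = e ^ (1 + a) := by
    rw [← Real.rpow_natCast e 3, ← Real.rpow_add he0]; congr 1; push_cast; ring
  have p4 : 1 ≤ e ^ (a - 2) := Real.one_le_rpow_of_pos_of_le_one_of_nonpos he0 he1 (by linarith)
  rw [hsplit, hF1, hF2]
  generalize (∫ t in (0:ℝ)..e, r1 t * Real.sin (t * l)) = X at *
  generalize (∫ t in Set.Ioi e, r3 t * Real.sin (t * l)) = Y at *
  have eqn : e * (r0 e * Real.sin 1) - e * X + (e ^ 3 * Y - (e * (r0 e * Real.sin 1) + e ^ 2 * (r1 e * Real.cos 1) - e ^ 3 * (r2 e * Real.sin 1)))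
    = -(e * X) + e ^ 3 * Y + - (e ^ 2 * (r1 e * Real.cos 1)) + e ^ 3 * (r2 e * Real.sin 1) := by ring
  rw [eqn]
  refine (abs_add_le _ _).trans ((add_le_add_left ((abs_add_le _ _).trans (add_le_add_left (abs_add_le _ _) _)) _).trans ?_)
  simp only [abs_neg, abs_mul, abs_of_pos he0, abs_of_pos (pow_pos he0 2), abs_of_pos (pow_pos he0 3)]
  have c1 : e * |X| ≤ C * (1 / a) * e ^ (1 + a) := by
    calc e * |X| ≤ e * (C * (e ^ a / a)) := by gcongr
      _ = C * (1 / a) * (e * e ^ a) := by ring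
      _ = _ := by rw [p1]
  have c2 : e ^ 2 * (|r1 e| * |Real.cos 1|) ≤ C * e ^ (1 + a) := by
    calc e ^ 2 * (|r1 e| * |Real.cos 1|) ≤ e ^ 2 * ((C * e ^ (a - 1)) * 1) := by
          gcongr; exact Real.abs_cos_le_one _
      _ = C * (e ^ 2 * e ^ (a - 1)) := by ring
      _ = _ := by rw [p2]
  have c3 : e ^ 3 * (|r2 e| * |Real.sin 1|) ≤ C * e ^ (1 + a) := by
    calc e ^ 3 * (|r2 e| * |Real.sin 1|) ≤ e ^ 3 * ((C * e ^ (a - 2)) * 1) := by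
          gcongr; exact Real.abs_sin_le_one _
      _ = C * (e ^ 3 * e ^ (a - 2)) := by ring
      _ = _ := by rw [p3]
  have c4 : e ^ 3 * |Y| ≤ C * (1 / (2 - a) + 1 / δ) * e ^ (1 + a) := by
    calc e ^ 3 * |Y| ≤ e ^ 3 * (C * (e ^ (a - 2) / (2 - a) + 1 / δ * e ^ (a - 2))) := by
          refine mul_le_mul_of_nonneg_left (hB3.trans ?_) (by positivity)
          gcongr
          exact le_mul_of_one_le_right (by positivity) p4
      _ = C * (1 / (2 - a) + 1 / δ) * (e ^ 3 * e ^ (a - 2)) := by ring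
      _ = _ := by rw [p3]
  nlinarith [c1, c2, c3, c4]

noncomputable def sdS (t : ℝ) : ℝ := Real.exp (t / 2) - Real.exp (-(t / 2))
noncomputable def sdk (t : ℝ) : ℝ := (Real.exp (t / 2) + Real.exp (-(t / 2))) / 2
noncomputable def sdC (H t : ℝ) : ℝ := Real.exp (H * t) + Real.exp (-(H * t))
noncomputable def sdD (H t : ℝ) : ℝ := H * (Real.exp (H * t) - Real.exp (-(H * t)))

lemma sdS_deriv (t : ℝ) : HasDerivAt sdS (sdk t) t := by
  have h1 := ((hasDerivAt_id t).div_const 2).exp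
  have h2 := ((hasDerivAt_id t).div_const 2).neg.exp
  refine HasDerivAt.congr_deriv (h1.sub h2) ?_
  simp [sdk]; ring

lemma sdk_deriv (t : ℝ) : HasDerivAt sdk (sdS t / 4) t := by
  have h1 := ((hasDerivAt_id t).div_const 2).exp
  have h2 := ((hasDerivAt_id t).div_const 2).neg.exp
  refine HasDerivAt.congr_deriv ((h1.add h2).div_const 2) ?_
  simp [sdS]; ring

lemma sdC_deriv (H t : ℝ) : HasDerivAt (sdC H) (sdD H t) t := by
  have h1 := ((hasDerivAt_id t).const_mul H).exp
  have h2 := ((hasDerivAt_id t).const_mul H).neg.exp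
  refine HasDerivAt.congr_deriv (h1.add h2) ?_
  simp [sdD]; ring

lemma sdD_deriv (H t : ℝ) : HasDerivAt (sdD H) (H ^ 2 * sdC H t) t := by
  have h1 := ((hasDerivAt_id t).const_mul H).exp
  have h2 := ((hasDerivAt_id t).const_mul H).neg.exp
  refine HasDerivAt.congr_deriv ((h1.sub h2).const_mul H) ?_
  simp [sdC]; ring

lemma sdk_sq (t : ℝ) : sdk t ^ 2 = 1 + sdS t ^ 2 / 4 := by
  have h : Real.exp (t / 2) * Real.exp (-(t / 2)) = 1 := by rw [← Real.exp_add]; simp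
  unfold sdk sdS
  linear_combination h

lemma sdD_sq (H t : ℝ) : sdD H t ^ 2 = H ^ 2 * (sdC H t ^ 2 - 4) := by
  have h : Real.exp (H * t) * Real.exp (-(H * t)) = 1 := by rw [← Real.exp_add]; simp
  unfold sdD sdC
  linear_combination (-4 * H ^ 2) * h

lemma sdk_eq (t : ℝ) : sdk t = sdS t / 2 + Real.exp (-(t / 2)) := by
  unfold sdk sdS; ring

lemma sdD_eq (H t : ℝ) : sdD H t = H * (sdC H t - 2 * Real.exp (-(H * t))) := by
  unfold sdD sdC; ring

lemma sdk_pos (t : ℝ) : 0 < sdk t := by unfold sdk; positivity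
lemma sdC_pos (H t : ℝ) : 0 < sdC H t := by unfold sdC; positivity

lemma sdC_ge (H t : ℝ) : 1 ≤ sdC H t := by
  unfold sdC
  nlinarith [Real.add_one_le_exp (H * t), Real.add_one_le_exp (-(H * t))]

lemma sdC_ge_exp (H t : ℝ) : Real.exp (H * t) ≤ sdC H t := by
  unfold sdC
  linarith [Real.exp_pos (-(H * t))]

lemma sdS_ge {t : ℝ} (ht : 0 < t) : t ≤ sdS t := by
  have h := Real.self_le_sinh_iff.2 (by linarith : (0:ℝ) ≤ t / 2)
  rw [Real.sinh_eq] at h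
  unfold sdS
  linarith

lemma sdS_pos {t : ℝ} (ht : 0 < t) : 0 < sdS t := ht.trans_le (sdS_ge ht)

lemma sd_exp_sub {x : ℝ} (h0 : 0 ≤ x) (h1 : x ≤ 1) : Real.exp x - Real.exp (-x) ≤ 4 * x := by
  have h := Real.abs_exp_sub_one_sub_id_le (x := x) (by rw [abs_of_nonneg h0]; exact h1)
  have h2 := (abs_le.1 h).2
  nlinarith [Real.add_one_le_exp (-x)]

lemma sdS_le {t : ℝ} (ht : 0 < t) (h1 : t ≤ 1) : sdS t ≤ 2 * t := by
  have := sd_exp_sub (x := t / 2) (by linarith) (by linarith)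
  unfold sdS; linarith

lemma sdS_le_exp (t : ℝ) : sdS t ≤ Real.exp (t / 2) := by
  unfold sdS; linarith [Real.exp_pos (-(t / 2))]

lemma sdk_le {t : ℝ} (ht : 0 < t) (h1 : t ≤ 1) : sdk t ≤ 2 := by
  rw [sdk_eq]
  have := sdS_le ht h1
  have : Real.exp (-(t / 2)) ≤ 1 := Real.exp_le_one_iff.2 (by linarith)
  linarith

lemma sdD_nonneg {H t : ℝ} (hH : 0 < H) (ht : 0 < t) : 0 ≤ sdD H t := by
  unfold sdD
  have : Real.exp (-(H * t)) ≤ Real.exp (H * t) := Real.exp_le_exp.2 (by nlinarith [mul_pos hH ht])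
  exact mul_nonneg hH.le (by linarith)

lemma sdD_le {H t : ℝ} (hH : 0 < H) (hH1 : H < 1) (ht : 0 < t) (h1 : t ≤ 1) : sdD H t ≤ 4 * t := by
  have hp := mul_pos hH ht
  have := sd_exp_sub (x := H * t) hp.le (by nlinarith)
  unfold sdD
  calc H * (Real.exp (H * t) - Real.exp (-(H * t))) ≤ H * (4 * (H * t)) := by gcongr
    _ = (H * H) * (4 * t) := by ring
    _ ≤ 1 * (4 * t) := by gcongr; nlinarith
    _ = _ := by ring

lemma sdD_le_C {H t : ℝ} (hH : 0 < H) (hH1 : H < 1) : sdD H t ≤ sdC H t := by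
  rw [sdD_eq]
  nlinarith [sdC_pos H t, Real.exp_pos (-(H * t))]

/-- `s^(a-1) ≤ 2 t^(a-1)` near zero. -/
lemma sdS_rpow_le {a t : ℝ} (ha : a < 2) (ht : 0 < t) (h1 : t ≤ 1) :
    sdS t ^ (a - 1) ≤ 2 * t ^ (a - 1) := by
  have hs := sdS_ge ht
  have hs2 := sdS_le ht h1
  have h : sdS t = (sdS t / t) * t := by field_simp
  have q1 : 1 ≤ sdS t / t := by rw [le_div_iff₀ ht]; linarith
  have q2 : sdS t / t ≤ 2 := by rw [div_le_iff₀ ht]; linarith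
  rw [h, Real.mul_rpow (by linarith) ht.le]
  gcongr
  calc (sdS t / t) ^ (a - 1) ≤ (sdS t / t) ^ (1:ℝ) := Real.rpow_le_rpow_of_exponent_le q1 (by linarith)
    _ ≤ 2 := by rw [Real.rpow_one]; exact q2

lemma sdS_rpow_neg {p t : ℝ} (hp : p ≤ 0) (ht : 0 < t) : sdS t ^ p ≤ t ^ p :=
  Real.rpow_le_rpow_of_nonpos ht (sdS_ge ht) hp

lemma sdS_m {a δ t : ℝ} (ha : 0 < a) (ha2 : a < 2) (hδ : δ ≤ 1 - a / 2) (ht : 0 < t) :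
    sdS t ^ (a - 2) ≤ 4 * (t ^ (a - 3) + Real.exp (-δ * t)) := by
  have e1 := Real.exp_pos (-δ * t)
  have e2 := Real.rpow_pos_of_pos ht (a - 3)
  rcases le_total t 1 with h1 | h1
  · have q1 := sdS_rpow_neg (p := a - 2) (by linarith) ht
    have q2 : t ^ (a - 2) ≤ t ^ (a - 3) := Real.rpow_le_rpow_of_exponent_ge ht h1 (by linarith)
    linarith
  · have q : Real.exp (t / 2) / 2 ≤ sdS t := by
      unfold sdS
      have q3 : Real.exp (-(t / 2)) = Real.exp (t / 2) * Real.exp (-t) := by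
        rw [← Real.exp_add]; congr 1; ring
      have q4 : Real.exp (-t) ≤ 1 / 2 := by
        rw [Real.exp_neg, inv_le_comm₀ (Real.exp_pos _) (by norm_num)]
        linarith [Real.add_one_le_exp t]
      rw [q3]
      nlinarith [Real.exp_pos (t / 2)]
    have q5 : sdS t ^ (a - 2) ≤ (Real.exp (t / 2) / 2) ^ (a - 2) :=
      Real.rpow_le_rpow_of_nonpos (by positivity) q (by linarith)
    have q6 : (Real.exp (t / 2) / 2) ^ (a - 2) = Real.exp (t / 2 * (a - 2)) * 2 ^ (2 - a) := by
      rw [div_eq_mul_inv, Real.mul_rpow (by positivity) (by positivity), ← Real.exp_mul,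
        Real.inv_rpow (by norm_num), ← Real.rpow_neg (by norm_num)]
      congr 2; ring
    have q7 : (2:ℝ) ^ (2 - a) ≤ 4 := by
      calc (2:ℝ) ^ (2 - a) ≤ (2:ℝ) ^ (2:ℝ) := Real.rpow_le_rpow_of_exponent_le (by norm_num) (by linarith)
        _ = 4 := by norm_num
    have q8 : Real.exp (t / 2 * (a - 2)) ≤ Real.exp (-δ * t) := Real.exp_le_exp.2 (by nlinarith)
    have q9 : Real.exp (t / 2 * (a - 2)) * 2 ^ (2 - a) ≤ Real.exp (-δ * t) * 4 := by gcongr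
    linarith

noncomputable def sdr0 (H K t : ℝ) : ℝ := (2 : ℝ) ^ (-K) * (sdC H t ^ K - sdS t ^ (2 * H * K))
noncomputable def sdr1 (H K t : ℝ) : ℝ := (2 : ℝ) ^ (-K) *
  (K * sdC H t ^ (K - 1) * sdD H t - (2 * H * K) * sdS t ^ (2 * H * K - 1) * sdk t)
noncomputable def sdr2 (H K t : ℝ) : ℝ := (H * K) ^ 2 * sdr0 H K t + (2 : ℝ) ^ (-K) *
  (4 * K * (1 - K) * H ^ 2 * sdC H t ^ (K - 2)
    - (2 * H * K) * (2 * H * K - 1) * sdS t ^ (2 * H * K - 2))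
noncomputable def sdr3 (H K t : ℝ) : ℝ := (H * K) ^ 2 * sdr1 H K t + (2 : ℝ) ^ (-K) *
  (4 * K * (1 - K) * H ^ 2 * ((K - 2) * sdC H t ^ (K - 3) * sdD H t)
    - (2 * H * K) * (2 * H * K - 1) * ((2 * H * K - 2) * sdS t ^ (2 * H * K - 3) * sdk t))

lemma sdC_rpow_deriv (H p t : ℝ) :
    HasDerivAt (fun t => sdC H t ^ p) (p * sdC H t ^ (p - 1) * sdD H t) t := by
  refine HasDerivAt.congr_deriv ((sdC_deriv H t).rpow_const (p := p) (Or.inl (sdC_pos H t).ne')) ?_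
  ring

lemma sdS_rpow_deriv (p : ℝ) {t : ℝ} (ht : 0 < t) :
    HasDerivAt (fun t => sdS t ^ p) (p * sdS t ^ (p - 1) * sdk t) t := by
  refine HasDerivAt.congr_deriv ((sdS_deriv t).rpow_const (p := p) (Or.inl (sdS_pos ht).ne')) ?_
  ring

lemma sdr0_deriv (H K : ℝ) {t : ℝ} (ht : 0 < t) : HasDerivAt (sdr0 H K) (sdr1 H K t) t :=
  ((sdC_rpow_deriv H K t).sub (sdS_rpow_deriv (2 * H * K) ht)).const_mul _

lemma sdr1_deriv (H K : ℝ) {t : ℝ} (ht : 0 < t) : HasDerivAt (sdr1 H K) (sdr2 H K t) t := by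
  have h1 := ((sdC_rpow_deriv H (K - 1) t).const_mul K).mul (sdD_deriv H t)
  have h2 := ((sdS_rpow_deriv (2 * H * K - 1) ht).const_mul (2 * H * K)).mul (sdk_deriv t)
  refine HasDerivAt.congr_deriv ((h1.sub h2).const_mul ((2:ℝ) ^ (-K))) ?_
  have hC := sdC_pos H t
  have hS := sdS_pos ht
  have c1 : sdC H t ^ (K - 1) = sdC H t ^ (K - 2) * sdC H t := by
    rw [← Real.rpow_add_one hC.ne']; congr 1; ring
  have c0 : sdC H t ^ K = sdC H t ^ (K - 2) * sdC H t * sdC H t := by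
    rw [← c1, ← Real.rpow_add_one hC.ne']; congr 1; ring
  have s1 : sdS t ^ (2 * H * K - 1) = sdS t ^ (2 * H * K - 2) * sdS t := by
    rw [← Real.rpow_add_one hS.ne']; congr 1; ring
  have s0 : sdS t ^ (2 * H * K) = sdS t ^ (2 * H * K - 2) * sdS t * sdS t := by
    rw [← s1, ← Real.rpow_add_one hS.ne']; congr 1; ring
  have e1 : K - 1 - 1 = K - 2 := by ring
  have e2 : 2 * H * K - 1 - 1 = 2 * H * K - 2 := by ring
  have hk := sdk_sq t
  have hD := sdD_sq H t
  simp only [e1, e2, sdr2, sdr0]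
  rw [c1, c0, s1, s0]
  symm
  linear_combination (2:ℝ) ^ (-K) * (-(K * (K - 1) * sdC H t ^ (K - 2)) * hD
    + (2 * H * K) * (2 * H * K - 1) * sdS t ^ (2 * H * K - 2) * hk)

lemma sdr2_deriv (H K : ℝ) {t : ℝ} (ht : 0 < t) : HasDerivAt (sdr2 H K) (sdr3 H K t) t := by
  have h1 := (sdC_rpow_deriv H (K - 2) t).const_mul (4 * K * (1 - K) * H ^ 2)
  have h2 := (sdS_rpow_deriv (2 * H * K - 2) ht).const_mul ((2 * H * K) * (2 * H * K - 1))
  refine HasDerivAt.congr_deriv (((sdr0_deriv H K ht).const_mul ((H * K) ^ 2)).add ((h1.sub h2).const_mul ((2:ℝ) ^ (-K)))) ?_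
  have e1 : K - 2 - 1 = K - 3 := by ring
  have e2 : 2 * H * K - 2 - 1 = 2 * H * K - 3 := by ring
  simp only [e1, e2, sdr3]

lemma sdr3_cont (H K : ℝ) : ContinuousOn (sdr3 H K) (Set.Ioi 0) := by
  intro t ht
  have h1 := (sdr1_deriv H K ht).continuousAt
  have h2 := (sdC_rpow_deriv H (K - 3) t).continuousAt
  have h3 := (sdS_rpow_deriv (2 * H * K - 3) ht).continuousAt
  have h4 := (sdk_deriv t).continuousAt
  have h5 := (sdD_deriv H t).continuousAt
  apply ContinuousAt.continuousWithinAt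
  unfold sdr3
  fun_prop

lemma sdr0_cont {H K : ℝ} (hp : 0 ≤ 2 * H * K) : Continuous (sdr0 H K) := by
  have h1 : Continuous (fun t => sdC H t ^ K) :=
    continuous_iff_continuousAt.2 fun t => (sdC_rpow_deriv H K t).continuousAt
  have h2 : Continuous sdS := continuous_iff_continuousAt.2 fun t => (sdS_deriv t).continuousAt
  have h3 : Continuous (fun t => sdS t ^ (2 * H * K)) := h2.rpow_const fun _ => Or.inr hp
  unfold sdr0
  fun_prop

lemma sdr0_eq_rcov (H K : ℝ) {t : ℝ} (ht : 0 ≤ t) : rcov H K t = sdr0 H K t := by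
  have e1 : sdC H t = Real.exp (H * t) * (1 + Real.exp (-2 * H * t)) := by
    unfold sdC; rw [mul_add, ← Real.exp_add, mul_one]; congr 2; ring
  have e2 : sdS t = Real.exp (t / 2) * (1 - Real.exp (-t)) := by
    unfold sdS; rw [mul_sub, ← Real.exp_add, mul_one]; congr 2; ring
  have e3 : 0 ≤ 1 - Real.exp (-t) := by
    have : Real.exp (-t) ≤ 1 := Real.exp_le_one_iff.2 (by linarith)
    linarith
  unfold rcov sdr0
  rw [e1, e2, abs_of_nonneg ht, Real.mul_rpow (by positivity) (by positivity),
    Real.mul_rpow (by positivity) e3, ← Real.exp_mul, ← Real.exp_mul,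
    show t / 2 * (2 * H * K) = H * K * t by ring, show H * t * K = H * K * t by ring]
  ring

lemma sd_c_le {K : ℝ} (hK : 0 < K) : (2:ℝ) ^ (-K) ≤ 1 :=
  Real.rpow_le_one_of_one_le_of_nonpos (by norm_num) (by linarith)

lemma sdr0_bound {H K δ t : ℝ} (hH : 0 < H) (hH1 : H < 1) (hK : 0 < K) (hK1 : K ≤ 1)
    (hδ : δ ≤ H) (hδ2 : δ ≤ 1 - H * K) (ht : 0 ≤ t) : |sdr0 H K t| ≤ 3 * Real.exp (-δ * t) := by
  rw [← sdr0_eq_rcov H K ht]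
  unfold rcov
  rw [abs_of_nonneg ht]
  have hx := Real.exp_pos (-2 * H * t)
  have hw := Real.exp_pos (-t)
  have hw1 : Real.exp (-t) ≤ 1 := Real.exp_le_one_iff.2 (by linarith)
  have a1 : (1 + Real.exp (-2 * H * t)) ^ K ≤ 1 + K * Real.exp (-2 * H * t) :=
    rpow_one_add_le_one_add_mul_self (by linarith) hK.le hK1
  have a2 : 1 ≤ (1 + Real.exp (-2 * H * t)) ^ K := Real.one_le_rpow (by linarith) hK.le
  have a3 : (1 - Real.exp (-t)) ^ (2 * H * K) ≤ 1 :=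
    Real.rpow_le_one (by linarith) (by linarith) (by positivity)
  have a4 : 1 - 2 * Real.exp (-t) ≤ (1 - Real.exp (-t)) ^ (2 * H * K) := by
    rcases eq_or_lt_of_le hw1 with h | h
    · rw [h, sub_self, Real.zero_rpow (by positivity)]; norm_num
    calc 1 - 2 * Real.exp (-t) ≤ (1 - Real.exp (-t)) ^ 2 := by nlinarith
      _ = (1 - Real.exp (-t)) ^ (2:ℝ) := by norm_num
      _ ≤ _ := Real.rpow_le_rpow_of_exponent_ge (by linarith) (by linarith) (by nlinarith)
  have hc := sd_c_le hK
  have hc0 : (0:ℝ) < 2 ^ (-K) := by positivity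
  have b1 : Real.exp (H * K * t) * Real.exp (-2 * H * t) ≤ Real.exp (-δ * t) := by
    rw [← Real.exp_add, Real.exp_le_exp]
    nlinarith [mul_nonneg (sub_nonneg.2 hδ) ht, mul_nonneg (mul_nonneg hH.le (sub_nonneg.2 hK1)) ht]
  have b2 : Real.exp (H * K * t) * Real.exp (-t) ≤ Real.exp (-δ * t) := by
    rw [← Real.exp_add, Real.exp_le_exp]
    nlinarith [mul_nonneg (sub_nonneg.2 hδ2) ht]
  have e0 := Real.exp_pos (H * K * t)
  rw [abs_of_nonneg (mul_nonneg (by positivity) (by linarith))]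
  calc _ ≤ 1 * Real.exp (H * K * t) * (Real.exp (-2 * H * t) + 2 * Real.exp (-t)) := by
        gcongr
        · linarith
        · nlinarith
    _ = Real.exp (H * K * t) * Real.exp (-2 * H * t) + 2 * (Real.exp (H * K * t) * Real.exp (-t)) := by ring
    _ ≤ _ := by linarith

lemma sdr1_eq (H K : ℝ) {t : ℝ} (ht : 0 < t) : sdr1 H K t = H * K * sdr0 H K t
    - (2:ℝ) ^ (-K) * (2 * H * K) * (sdC H t ^ (K - 1) * Real.exp (-(H * t))
      + sdS t ^ (2 * H * K - 1) * Real.exp (-(t / 2))) := by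
  have c0 : sdC H t ^ K = sdC H t ^ (K - 1) * sdC H t := by
    rw [← Real.rpow_add_one (sdC_pos H t).ne']; congr 1; ring
  have s0 : sdS t ^ (2 * H * K) = sdS t ^ (2 * H * K - 1) * sdS t := by
    rw [← Real.rpow_add_one (sdS_pos ht).ne']; congr 1; ring
  unfold sdr1 sdr0
  rw [c0, s0, sdk_eq, sdD_eq]
  ring

lemma sdC_neg {H p t : ℝ} (hp : p ≤ 0) : sdC H t ^ p ≤ 1 :=
  Real.rpow_le_one_of_one_le_of_nonpos (sdC_ge H t) hp

/-- bound valid for all `t > 0`. -/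
lemma sdr1_bound {H K δ t : ℝ} (hH : 0 < H) (hH1 : H < 1) (hK : 0 < K) (hK1 : K ≤ 1)
    (hδ : δ ≤ H) (hδ2 : δ ≤ 1 - H * K) (ht : 0 < t) :
    |sdr1 H K t| ≤ 5 * Real.exp (-δ * t) + 2 * sdS t ^ (2 * H * K - 2) := by
  have hHK : H * K < 1 := by nlinarith
  have hHK0 := mul_pos hH hK
  have hS := sdS_pos ht
  rw [sdr1_eq H K ht]
  have h0 := sdr0_bound hH hH1 hK hK1 hδ hδ2 ht.le
  have s0 : sdS t ^ (2 * H * K - 1) = sdS t ^ (2 * H * K - 2) * sdS t := by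
    rw [← Real.rpow_add_one hS.ne']; congr 1; ring
  have hm := Real.rpow_pos_of_pos hS (2 * H * K - 2)
  have g1 : sdS t ^ (2 * H * K - 1) * Real.exp (-(t / 2)) ≤ sdS t ^ (2 * H * K - 2) := by
    rw [s0, mul_assoc]
    refine mul_le_of_le_one_right hm.le ?_
    calc sdS t * Real.exp (-(t / 2)) ≤ Real.exp (t / 2) * Real.exp (-(t / 2)) := by
          gcongr; exact sdS_le_exp t
      _ = 1 := by rw [← Real.exp_add]; simp
  have g1' : 0 ≤ sdS t ^ (2 * H * K - 1) * Real.exp (-(t / 2)) := by positivity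
  have g2 : sdC H t ^ (K - 1) * Real.exp (-(H * t)) ≤ Real.exp (-δ * t) := by
    calc sdC H t ^ (K - 1) * Real.exp (-(H * t)) ≤ 1 * Real.exp (-δ * t) := by
          gcongr
          · exact sdC_neg (by linarith)
          · nlinarith
      _ = _ := one_mul _
  have g2' : 0 ≤ sdC H t ^ (K - 1) * Real.exp (-(H * t)) :=
    mul_nonneg (Real.rpow_nonneg (sdC_pos H t).le _) (Real.exp_pos _).le
  have hc := sd_c_le hK
  have hc0 : (0:ℝ) < 2 ^ (-K) := by positivity
  refine (abs_sub _ _).trans ?_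
  rw [abs_mul, abs_of_pos hHK0, abs_of_nonneg (a := _ * _ * _) (by positivity)]
  have f1 : H * K * |sdr0 H K t| ≤ 1 * (3 * Real.exp (-δ * t)) := by gcongr
  have f2 : (2:ℝ) ^ (-K) * (2 * H * K) * (sdC H t ^ (K - 1) * Real.exp (-(H * t))
      + sdS t ^ (2 * H * K - 1) * Real.exp (-(t / 2))) ≤ 1 * 2 * (Real.exp (-δ * t) + sdS t ^ (2 * H * K - 2)) := by
    gcongr
    nlinarith
  linarith

lemma sdr1_bound_zero {H K t : ℝ} (hH : 0 < H) (hH1 : H < 1) (hK : 0 < K) (hK1 : K ≤ 1)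
    (ht : 0 < t) (h1 : t ≤ 1) : |sdr1 H K t| ≤ 12 * t ^ (2 * H * K - 1) := by
  have hHK : H * K < 1 := by nlinarith
  have hHK0 := mul_pos hH hK
  have hS := sdS_pos ht
  have hc := sd_c_le hK
  have hc0 : (0:ℝ) < 2 ^ (-K) := by positivity
  have hk := sdk_pos t
  have hC := Real.rpow_nonneg (sdC_pos H t).le (K - 1)
  have hD := sdD_nonneg hH ht
  have hS' := Real.rpow_nonneg hS.le (2 * H * K - 1)
  have f1 : K * sdC H t ^ (K - 1) * sdD H t ≤ 1 * 1 * (4 * t) := by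
    gcongr
    · exact sdC_neg (by linarith)
    · exact sdD_le hH hH1 ht h1
  have f2 : (2 * H * K) * sdS t ^ (2 * H * K - 1) * sdk t ≤ 2 * (2 * t ^ (2 * H * K - 1)) * 2 := by
    gcongr
    · nlinarith
    · exact sdS_rpow_le (by nlinarith) ht h1
    · exact sdk_le ht h1
  have f3 : t ≤ t ^ (2 * H * K - 1) := by
    calc t = t ^ (1:ℝ) := by simp
      _ ≤ _ := Real.rpow_le_rpow_of_exponent_ge ht h1 (by nlinarith)
  unfold sdr1
  rw [abs_mul, abs_of_pos hc0]
  have f4 : |K * sdC H t ^ (K - 1) * sdD H t - (2 * H * K) * sdS t ^ (2 * H * K - 1) * sdk t| ≤ 12 * t ^ (2 * H * K - 1) := by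
    refine (abs_sub _ _).trans ?_
    rw [abs_of_nonneg (by positivity), abs_of_nonneg (by positivity)]
    linarith
  calc _ ≤ 1 * (12 * t ^ (2 * H * K - 1)) := by gcongr
    _ = _ := one_mul _

lemma sdC_exp_le {H K δ t : ℝ} (hK1 : K ≤ 1) (hδ : δ ≤ H) (ht : 0 < t) :
    sdC H t ^ (K - 2) ≤ Real.exp (-δ * t) := by
  calc sdC H t ^ (K - 2) ≤ sdC H t ^ (-1:ℝ) :=
        Real.rpow_le_rpow_of_exponent_le (sdC_ge H t) (by linarith)
    _ = (sdC H t)⁻¹ := Real.rpow_neg_one _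
    _ ≤ (Real.exp (H * t))⁻¹ := inv_anti₀ (Real.exp_pos _) (sdC_ge_exp H t)
    _ = Real.exp (-(H * t)) := (Real.exp_neg _).symm
    _ ≤ _ := Real.exp_le_exp.2 (by nlinarith)

lemma sd_coef {H K : ℝ} (hH : 0 < H) (hH1 : H < 1) (hK : 0 < K) (hK1 : K ≤ 1) :
    |4 * K * (1 - K) * H ^ 2| ≤ 4 ∧ |(2 * H * K) * (2 * H * K - 1)| ≤ 2 := by
  have hHK : H * K < 1 := by nlinarith
  have hHK0 := mul_pos hH hK
  constructor
  · rw [abs_of_nonneg (mul_nonneg (mul_nonneg (by positivity) (by linarith)) (by positivity))]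
    calc 4 * K * (1 - K) * H ^ 2 ≤ 4 * 1 * 1 * 1 ^ 2 := by
          have : 0 ≤ 1 - K := by linarith
          gcongr
          linarith
      _ = 4 := by norm_num
  · rw [abs_le]; constructor <;> nlinarith

lemma sdr2_bound {H K δ t : ℝ} (hH : 0 < H) (hH1 : H < 1) (hK : 0 < K) (hK1 : K ≤ 1)
    (hδ : δ ≤ H) (hδ2 : δ ≤ 1 - H * K) (ht : 0 < t) :
    |sdr2 H K t| ≤ 7 * Real.exp (-δ * t) + 2 * sdS t ^ (2 * H * K - 2) := by
  have hHK : H * K < 1 := by nlinarith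
  have hHK0 := mul_pos hH hK
  have hS := sdS_pos ht
  have h0 := sdr0_bound hH hH1 hK hK1 hδ hδ2 ht.le
  have hc := sd_c_le hK
  have hc0 : (0:ℝ) < 2 ^ (-K) := by positivity
  obtain ⟨k1, k2⟩ := sd_coef hH hH1 hK hK1
  have hC := Real.rpow_nonneg (sdC_pos H t).le (K - 2)
  have hS' := Real.rpow_nonneg hS.le (2 * H * K - 2)
  have f1 : |4 * K * (1 - K) * H ^ 2 * sdC H t ^ (K - 2)| ≤ 4 * Real.exp (-δ * t) := by
    rw [abs_mul, abs_of_nonneg hC]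
    gcongr
    exact sdC_exp_le hK1 hδ ht
  have f2 : |(2 * H * K) * (2 * H * K - 1) * sdS t ^ (2 * H * K - 2)| ≤ 2 * sdS t ^ (2 * H * K - 2) := by
    rw [abs_mul, abs_of_nonneg hS']
    gcongr
  have f3 : |(H * K) ^ 2 * sdr0 H K t| ≤ 1 ^ 2 * (3 * Real.exp (-δ * t)) := by
    rw [abs_mul, abs_of_nonneg (by positivity)]
    gcongr
  unfold sdr2
  refine (abs_add_le _ _).trans ?_
  rw [abs_mul ((2:ℝ) ^ (-K)), abs_of_pos hc0]
  have f4 := (abs_sub (4 * K * (1 - K) * H ^ 2 * sdC H t ^ (K - 2)) ((2 * H * K) * (2 * H * K - 1) * sdS t ^ (2 * H * K - 2))).trans (add_le_add f1 f2)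
  have f5 := mul_le_mul hc f4 (abs_nonneg _) (by norm_num)
  linarith

lemma sdr3_bound {H K δ t : ℝ} (hH : 0 < H) (hH1 : H < 1) (hK : 0 < K) (hK1 : K ≤ 1)
    (hδ : δ ≤ H) (hδ2 : δ ≤ 1 - H * K) (ht : 0 < t) :
    |sdr3 H K t| ≤ 100 * (t ^ (2 * H * K - 3) + Real.exp (-δ * t)) := by
  have hHK : H * K < 1 := by nlinarith
  have hHK0 := mul_pos hH hK
  have hS := sdS_pos ht
  have h1 := sdr1_bound hH hH1 hK hK1 hδ hδ2 ht
  have hm := sdS_m (a := 2 * H * K) (δ := δ) (by nlinarith) (by nlinarith) (by linarith) ht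
  have hc := sd_c_le hK
  have hc0 : (0:ℝ) < 2 ^ (-K) := by positivity
  obtain ⟨k1, k2⟩ := sd_coef hH hH1 hK hK1
  have hC3 := Real.rpow_nonneg (sdC_pos H t).le (K - 3)
  have hS3 := Real.rpow_nonneg hS.le (2 * H * K - 3)
  have hS3' := sdS_rpow_neg (p := 2 * H * K - 3) (by nlinarith) ht
  have hD := sdD_nonneg hH ht
  have c0 : sdC H t ^ (K - 2) = sdC H t ^ (K - 3) * sdC H t := by
    rw [← Real.rpow_add_one (sdC_pos H t).ne']; congr 1; ring
  have s0 : sdS t ^ (2 * H * K - 2) = sdS t ^ (2 * H * K - 3) * sdS t := by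
    rw [← Real.rpow_add_one hS.ne']; congr 1; ring
  have g1 : |(K - 2) * sdC H t ^ (K - 3) * sdD H t| ≤ 2 * Real.exp (-δ * t) := by
    rw [mul_assoc, abs_mul, abs_of_nonneg (mul_nonneg hC3 hD)]
    have : sdC H t ^ (K - 3) * sdD H t ≤ Real.exp (-δ * t) := by
      refine le_trans ?_ (sdC_exp_le hK1 hδ ht)
      rw [c0]
      gcongr
      exact sdD_le_C hH hH1
    gcongr
    rw [abs_le]; constructor <;> linarith
  have g2 : |(2 * H * K - 2) * sdS t ^ (2 * H * K - 3) * sdk t| ≤ 2 * (sdS t ^ (2 * H * K - 2) / 2 + t ^ (2 * H * K - 3)) := by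
    rw [mul_assoc, abs_mul, abs_of_nonneg (mul_nonneg hS3 (sdk_pos t).le)]
    have : sdS t ^ (2 * H * K - 3) * sdk t ≤ sdS t ^ (2 * H * K - 2) / 2 + t ^ (2 * H * K - 3) := by
      rw [sdk_eq, s0]
      have : Real.exp (-(t / 2)) ≤ 1 := Real.exp_le_one_iff.2 (by linarith)
      nlinarith
    have hk := sdk_pos t
    gcongr
    rw [abs_le]; constructor <;> nlinarith
  have f1 := mul_le_mul k1 g1 (abs_nonneg _) (by norm_num)
  have f2 := mul_le_mul k2 g2 (abs_nonneg _) (by norm_num)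
  rw [← abs_mul] at f1 f2
  have f3 : |(H * K) ^ 2 * sdr1 H K t| ≤ 1 ^ 2 * (5 * Real.exp (-δ * t) + 2 * sdS t ^ (2 * H * K - 2)) := by
    rw [abs_mul, abs_of_nonneg (by positivity)]
    gcongr
  unfold sdr3
  refine (abs_add_le _ _).trans ?_
  rw [abs_mul ((2:ℝ) ^ (-K)), abs_of_pos hc0]
  have f4 := (abs_sub (4 * K * (1 - K) * H ^ 2 * ((K - 2) * sdC H t ^ (K - 3) * sdD H t))
    ((2 * H * K) * (2 * H * K - 1) * ((2 * H * K - 2) * sdS t ^ (2 * H * K - 3) * sdk t))).trans (add_le_add f1 f2)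
  have f5 := mul_le_mul hc f4 (abs_nonneg _) (by norm_num)
  have e1 := Real.exp_pos (-δ * t)
  have e2 := Real.rpow_pos_of_pos ht (2 * H * K - 3)
  linarith

lemma sdS_tendsto {a : ℝ} (ha2 : a < 2) :
    Filter.Tendsto (fun t => sdS t ^ (a - 2)) Filter.atTop (nhds 0) := by
  have h : Filter.Tendsto (fun t : ℝ => t ^ (-(2 - a))) Filter.atTop (nhds 0) :=
    tendsto_rpow_neg_atTop (by linarith)
  refine squeeze_zero' ?_ ?_ h
  · filter_upwards [Filter.eventually_gt_atTop 0] with t ht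
    exact Real.rpow_nonneg (sdS_pos ht).le _
  · filter_upwards [Filter.eventually_gt_atTop 0] with t ht
    rw [neg_sub]
    exact sdS_rpow_neg (by linarith) ht

lemma sd_exp_tendsto {δ : ℝ} (hδ : 0 < δ) :
    Filter.Tendsto (fun t => Real.exp (-δ * t)) Filter.atTop (nhds 0) := by
  refine Real.tendsto_exp_atBot.comp ?_
  exact Filter.tendsto_id.const_mul_atTop_of_neg (by linarith)

lemma sd_tendsto_of_bound {g : ℝ → ℝ} {a δ A B : ℝ} (ha2 : a < 2) (hδ : 0 < δ)
    (hg : ∀ t, 0 < t → |g t| ≤ A * Real.exp (-δ * t) + B * sdS t ^ (a - 2)) :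
    Filter.Tendsto g Filter.atTop (nhds 0) := by
  refine squeeze_zero_norm' (a := fun t => A * Real.exp (-δ * t) + B * sdS t ^ (a - 2)) ?_ ?_
  · filter_upwards [Filter.eventually_gt_atTop 0] with t ht using hg t ht
  · simpa using ((sd_exp_tendsto hδ).const_mul A).add ((sdS_tendsto ha2).const_mul B)

lemma sd_integrable {H K δ : ℝ} (hH : 0 < H) (hH1 : H < 1) (hK : 0 < K) (hK1 : K ≤ 1)
    (hδ0 : 0 < δ) (hδ : δ ≤ H) (hδ2 : δ ≤ 1 - H * K) : IntegrableOn (sdr0 H K) (Set.Ioi 0) := by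
  refine Integrable.mono' ((exp_neg_integrableOn_Ioi 0 hδ0).const_mul 3)
    (sdr0_cont (by positivity)).aestronglyMeasurable ?_
  refine (ae_restrict_iff' measurableSet_Ioi).2 (Filter.Eventually.of_forall fun t ht => ?_)
  exact sdr0_bound hH hH1 hK hK1 hδ hδ2 (le_of_lt ht)

lemma sd_spec_eq (H K l : ℝ) : specDensity H K l
    = (1 / Real.pi) * ∫ t in Set.Ioi (0 : ℝ), sdr0 H K t * Real.cos (t * l) := by
  unfold specDensity
  congr 1
  refine setIntegral_congr_fun measurableSet_Ioi fun t ht => ?_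
  rw [sdr0_eq_rcov H K (le_of_lt ht)]

lemma sd_spec_neg (H K l : ℝ) : specDensity H K (-l) = specDensity H K l := by
  simp [specDensity]

lemma sd_main {H K : ℝ} (hH : 0 < H) (hH1 : H < 1) (hK : 0 < K) (hK1 : K ≤ 1) :
    Continuous (specDensity H K) ∧ ∃ M, 0 < M ∧ (∀ l, |specDensity H K l| ≤ M) ∧
      ∀ l, 1 ≤ l → |specDensity H K l| ≤ M * l ^ (-1 - 2 * H * K) := by
  have hHK : H * K < 1 := by nlinarith
  have hHK0 := mul_pos hH hK
  obtain ⟨δ, hδ0, hδ, hδ2⟩ : ∃ δ, 0 < δ ∧ δ ≤ H ∧ δ ≤ 1 - H * K :=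
    ⟨min H (1 - H * K), lt_min hH (by linarith), min_le_left _ _, min_le_right _ _⟩
  have hrint := sd_integrable hH hH1 hK hK1 hδ0 hδ hδ2
  have ha : 0 < 2 * H * K := by positivity
  have ha2 : 2 * H * K < 2 := by nlinarith
  have hcont := sdr0_cont (H := H) (K := K) ha.le
  have hpi : 1 / Real.pi ≤ 1 := by
    rw [div_le_one Real.pi_pos]; linarith [Real.pi_gt_three]
  have hpi0 : 0 < 1 / Real.pi := by positivity
  have hpt : ∀ l t : ℝ, ‖sdr0 H K t * Real.cos (t * l)‖ ≤ ‖sdr0 H K t‖ := fun l t => by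
    rw [norm_mul]
    exact mul_le_of_le_one_right (norm_nonneg _) (Real.abs_cos_le_one _)
  refine ⟨?_, ?_⟩
  · have : specDensity H K = fun l => (1 / Real.pi) * ∫ t in Set.Ioi (0 : ℝ), sdr0 H K t * Real.cos (t * l) :=
      funext (sd_spec_eq H K)
    rw [this]
    refine continuous_const.mul ?_
    refine continuous_of_dominated (bound := fun t => ‖sdr0 H K t‖) (fun l => ?_) (fun l => ?_) hrint.norm ?_
    · exact (by fun_prop : Continuous fun t => sdr0 H K t * Real.cos (t * l)).aestronglyMeasurable
    · exact Filter.Eventually.of_forall (hpt l)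
    · exact Filter.Eventually.of_forall fun t => by fun_prop
  have h100 : ∀ t : ℝ, 0 < t → t ≤ 1 → (0:ℝ) < t ^ (2 * H * K - 1) := fun t ht _ => Real.rpow_pos_of_pos ht _
  obtain ⟨M, hM, hb⟩ := sd_general (sdr0 H K) (sdr1 H K) (sdr2 H K) (sdr3 H K) (2 * H * K) 100 δ ha ha2
    (by norm_num) hδ0 hcont.continuousOn (fun t ht => sdr0_deriv H K ht) (fun t ht => sdr1_deriv H K ht)
    (fun t ht => sdr2_deriv H K ht) (sdr3_cont H K) hrint
    (sd_tendsto_of_bound (a := 2 * H * K) (A := 3) (B := 0) ha2 hδ0 fun t ht => by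
      simpa using sdr0_bound hH hH1 hK hK1 hδ hδ2 ht.le)
    (sd_tendsto_of_bound ha2 hδ0 fun t ht => sdr1_bound hH hH1 hK hK1 hδ hδ2 ht)
    (sd_tendsto_of_bound ha2 hδ0 fun t ht => sdr2_bound hH hH1 hK hK1 hδ hδ2 ht)
    (fun t ht h1 => by
      have := sdr1_bound_zero hH hH1 hK hK1 ht h1
      have := h100 t ht h1
      linarith)
    (fun t ht h1 => by
      have q1 := sdr2_bound hH hH1 hK hK1 hδ hδ2 ht
      have q2 := sdS_rpow_neg (p := 2 * H * K - 2) (by linarith) ht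
      have q3 : 1 ≤ t ^ (2 * H * K - 2) :=
        Real.one_le_rpow_of_pos_of_le_one_of_nonpos ht h1 (by linarith)
      have q4 : Real.exp (-δ * t) ≤ 1 := Real.exp_le_one_iff.2 (by nlinarith)
      linarith)
    (fun t ht => sdr3_bound hH hH1 hK hK1 hδ hδ2 ht)
  have hscale : ∀ l X : ℝ, |∫ t in Set.Ioi (0 : ℝ), sdr0 H K t * Real.cos (t * l)| ≤ X →
      |specDensity H K l| ≤ X := by
    intro l X hX
    rw [sd_spec_eq, abs_mul, abs_of_pos hpi0]
    exact (mul_le_of_le_one_left (abs_nonneg _) hpi).trans hX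
  have hN0 : 0 ≤ ∫ t in Set.Ioi (0 : ℝ), ‖sdr0 H K t‖ := by positivity
  refine ⟨M + ∫ t in Set.Ioi (0 : ℝ), ‖sdr0 H K t‖, by linarith, fun l => hscale l _ ?_, fun l hl => hscale l _ ?_⟩
  · have := norm_integral_le_of_norm_le hrint.norm (Filter.Eventually.of_forall (hpt l))
    rw [Real.norm_eq_abs] at this
    linarith
  · refine (hb l hl).trans ?_
    have := Real.rpow_pos_of_pos (by linarith : 0 < l) (-1 - 2 * H * K)
    gcongr
    linarith

/-- Lemma 2.2: truncation estimates for the spectral density `f` of the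
stationary process associated with bifractional Brownian motion: there are `c₅, c₆ > 0`
such that for all `u > 1`,
`∫_{|λ| < u} λ² f(λ) dλ ≤ c₅ u^{2(1-HK)}` and `∫_{|λ| ≥ u} f(λ) dλ ≤ c₆ u^{-2HK}`,
the integrands being integrable on the respective domains. -/
theorem specDensity_truncation_bounds (H K : ℝ)
    (hH : H ∈ Set.Ioo (0:ℝ) 1) (hK : K ∈ Set.Ioc (0:ℝ) 1) :
    ∃ c₅ c₆ : ℝ, 0 < c₅ ∧ 0 < c₆ ∧ ∀ u : ℝ, 1 < u →
      (IntegrableOn (fun lam : ℝ => lam ^ 2 * specDensity H K lam) (Set.Ioo (-u) u) ∧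
        (∫ lam in Set.Ioo (-u) u, lam ^ 2 * specDensity H K lam) ≤
          c₅ * u ^ (2 * (1 - H * K))) ∧
      (IntegrableOn (specDensity H K) {lam : ℝ | u ≤ |lam|} ∧
        (∫ lam in {lam : ℝ | u ≤ |lam|}, specDensity H K lam) ≤ c₆ * u ^ (-(2 * H * K))) := by
  obtain ⟨hH, hH1⟩ := hH
  obtain ⟨hK, hK1⟩ := hK
  obtain ⟨hc, M, hM, hB, hdec⟩ := sd_main hH hH1 hK hK1
  have hHK : H * K < 1 := by nlinarith
  have hHK0 := mul_pos hH hK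
  refine ⟨2 * (M / (2 * (1 - H * K))), 2 * (M / (2 * H * K)), ?_, ?_, ?_⟩
  · have : 0 < 1 - H * K := by linarith
    positivity
  · positivity
  intro u hu
  have hu0 : 0 < u := by linarith
  have hc2 : Continuous fun lam : ℝ => lam ^ 2 * specDensity H K lam := by fun_prop
  refine ⟨⟨?_, ?_⟩, ?_⟩
  · exact (hc2.integrableOn_Icc (a := -u) (b := u)).mono_set Set.Ioo_subset_Icc_self
  · have hhalf : ∫ l in (0:ℝ)..u, l ^ 2 * specDensity H K l
        ≤ M / (2 * (1 - H * K)) * u ^ (2 * (1 - H * K)) := by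
      have hi : IntervalIntegrable (fun l : ℝ => M * l ^ (1 - 2 * H * K)) volume 0 u :=
        (intervalIntegral.intervalIntegrable_rpow' (by linarith)).const_mul M
      have h := intervalIntegral.norm_integral_le_of_norm_le (f := fun l => l ^ 2 * specDensity H K l) hu0.le
        (Filter.Eventually.of_forall fun l hl => by
          rw [norm_mul, Real.norm_eq_abs, Real.norm_eq_abs, abs_of_nonneg (sq_nonneg l)]
          show _ ≤ M * l ^ (1 - 2 * H * K)
          have hl0 := hl.1
          rcases le_total l 1 with h1 | h1
          · have q : l ^ 2 ≤ l ^ (1 - 2 * H * K) := by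
              rw [← Real.rpow_natCast l 2]
              exact Real.rpow_le_rpow_of_exponent_ge hl0 h1 (by push_cast; nlinarith)
            calc l ^ 2 * |specDensity H K l| ≤ l ^ (1 - 2 * H * K) * M := by
                  gcongr
                  exact hB l
              _ = _ := mul_comm _ _
          · have q : l ^ 2 * l ^ (-1 - 2 * H * K) = l ^ (1 - 2 * H * K) := by
              rw [← Real.rpow_natCast l 2, ← Real.rpow_add hl0]; congr 1; push_cast; ring
            calc l ^ 2 * |specDensity H K l| ≤ l ^ 2 * (M * l ^ (-1 - 2 * H * K)) := by
                  gcongr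
                  exact hdec l h1
              _ = M * (l ^ 2 * l ^ (-1 - 2 * H * K)) := by ring
              _ = _ := by rw [q]) hi
      rw [intervalIntegral.integral_const_mul, integral_rpow (Or.inl (by linarith))] at h
      have e1 : 1 - 2 * H * K + 1 = 2 * (1 - H * K) := by ring
      rw [e1, Real.zero_rpow (by linarith), sub_zero] at h
      refine (Real.le_norm_self _).trans (h.trans (le_of_eq ?_))
      ring
    have hneg : ∫ l in (-u)..(0:ℝ), l ^ 2 * specDensity H K l = ∫ l in (0:ℝ)..u, l ^ 2 * specDensity H K l := by
      have := intervalIntegral.integral_comp_neg (a := 0) (b := u) (fun l => l ^ 2 * specDensity H K l)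
      rw [neg_zero] at this
      rw [← this]
      simp [sd_spec_neg]
    rw [← integral_Ioc_eq_integral_Ioo, ← intervalIntegral.integral_of_le (by linarith),
      ← intervalIntegral.integral_add_adjacent_intervals (b := 0) (hc2.intervalIntegrable _ _) (hc2.intervalIntegrable _ _),
      hneg]
    linarith
  · have hset : {lam : ℝ | u ≤ |lam|} = Set.Iic (-u) ∪ Set.Ici u := by
      ext l
      simp only [Set.mem_ofPred_eq, Set.mem_union, Set.mem_Iic, Set.mem_Ici, le_abs]
      constructor
      · rintro (h | h)
        · exact Or.inr h
        · exact Or.inl (by linarith)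
      · rintro (h | h)
        · exact Or.inr (by linarith)
        · exact Or.inl h
    have hp : IntegrableOn (fun l : ℝ => M * l ^ (-1 - 2 * H * K)) (Set.Ioi u) :=
      (integrableOn_Ioi_rpow_of_lt (by linarith) hu0).const_mul M
    have hpb : ∀ᵐ l ∂(volume.restrict (Set.Ioi u)), ‖specDensity H K l‖ ≤ M * l ^ (-1 - 2 * H * K) :=
      (ae_restrict_iff' measurableSet_Ioi).2 (Filter.Eventually.of_forall fun l hl => hdec l (by
        have : u < l := hl
        linarith))
    have hI : IntegrableOn (specDensity H K) (Set.Ioi u) :=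
      Integrable.mono' hp hc.aestronglyMeasurable hpb
    have hI2 : IntegrableOn (specDensity H K) (Set.Ici u) := by
      rw [integrableOn_Ici_iff_integrableOn_Ioi]; exact hI
    have hI1 : IntegrableOn (specDensity H K) (Set.Iic (-u)) := by
      have := hI2
      rw [← neg_neg u] at this
      have := this.comp_neg_Iic
      simpa [sd_spec_neg] using this
    have hbound : ∫ l in Set.Ioi u, specDensity H K l ≤ M / (2 * H * K) * u ^ (-(2 * H * K)) := by
      have h := norm_integral_le_of_norm_le hp hpb
      rw [integral_const_mul, integral_Ioi_rpow_of_lt (by linarith) hu0] at h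
      refine (Real.le_norm_self _).trans (h.trans (le_of_eq ?_))
      rw [show -1 - 2 * H * K + 1 = -(2 * H * K) by ring, neg_div_neg_eq]
      ring
    have hneg : ∫ l in Set.Iic (-u), specDensity H K l = ∫ l in Set.Ioi u, specDensity H K l := by
      have := integral_comp_neg_Iic (-u) (specDensity H K)
      rw [neg_neg] at this
      rw [← this]
      simp [sd_spec_neg]
    rw [hset]
    refine ⟨hI1.union hI2, ?_⟩
    rw [setIntegral_union _ measurableSet_Ici hI1 hI2, hneg, integral_Ici_eq_integral_Ioi]
    · linarith
    · rw [Set.disjoint_left]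
      intro l h1 h2
      simp only [Set.mem_Iic, Set.mem_Ici] at h1 h2
      linarith
end
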